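/- arXiv:1510.01574 — 7 statements merged into one kernel-verified Lean document; each statement's English description precedes it below -/
import Mathlib

section
/- Let A = {a} be a one-letter alphabet and identify each circular word ~a^n with the word a^n, so that circular languages over A are identified with subsets of a*. A language L ⊆ a* (closed trivially under conjugacy) is Păun generated (i.e., L is the language of some finite Păun circular splicing system) if and only if either L is a finite set, or there exist a finite subset L1 of a*, positive integers p, r, n with n = pr ≥ 2, the subgroup G' = {pk : k ∈ ℕ, 0 ≤ k ≤ r−1} of ℤ/nℤ, and a finite set G of positive integers whose reductions modulo n are exactly G' and whose minimum is n, such that L = L1 ∪ (a^G)^+, where a^G = {a^g : g ∈ G}, and max{ℓ : a^ℓ ∈ L1} < n = min{m : m ∈ G}. -/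
/-- Conjugacy of words: `w` and `w'` are conjugate iff `w = x ++ y` and `w' = y ++ x`. -/
def WordConj {A : Type*} (w w' : List A) : Prop :=
  ∃ x y : List A, w = x ++ y ∧ w' = y ++ x

/-- A Păun circular splicing rule `u1#u2$u3#u4`. -/
structure CircRule (A : Type*) where
  u1 : List A
  u2 : List A
  u3 : List A
  u4 : List A

/-- One circular splicing step (at the level of full linearizations): a rule
`u1#u2$u3#u4` applied to circular words with linearizations `u2 x u1` and `u4 y u3`
produces every linearization of the circular word `~(u2 x u1 u4 y u3)`. -/
def CircStep {A : Type*} (R : Set (CircRule A)) (L : Set (List A)) (w : List A) : Prop :=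
  ∃ r ∈ R, ∃ x y : List A,
    r.u2 ++ x ++ r.u1 ∈ L ∧ r.u4 ++ y ++ r.u3 ∈ L ∧
    WordConj w (r.u2 ++ x ++ r.u1 ++ r.u4 ++ y ++ r.u3)

/-- The full linearization of the circular language generated by the Păun circular
splicing system `(A, ~I, R)`: the smallest conjugacy-closed set of words containing all
conjugates of words of `I` and closed under the splicing steps. -/
def CircLang {A : Type*} (I : Set (List A)) (R : Set (CircRule A)) : Set (List A) :=
  ⋂₀ {L : Set (List A) |
      (∀ w ∈ I, ∀ w', WordConj w w' → w' ∈ L) ∧ ∀ w, CircStep R L w → w ∈ L}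

theorem unit_ext {w w' : List Unit} (h : w.length = w'.length) : w = w' :=
  List.ext_getElem h (fun _ _ _ => rfl)

theorem nat_core (S : Set ℕ) (hS : S.Infinite) (M : ℕ)
    (hadd : ∀ a ∈ S, ∀ b ∈ S, M ≤ a → M ≤ b → a + b ∈ S) :
    ∃ (p r n : ℕ) (G : Set ℕ), G.Finite ∧ 0 < p ∧ 0 < r ∧ n = p * r ∧ 2 ≤ n ∧
      (∀ g ∈ G, 0 < g) ∧
      (fun g : ℕ => (g : ZMod n)) '' G
          = {x : ZMod n | ∃ k : ℕ, k ≤ r - 1 ∧ x = ((p * k : ℕ) : ZMod n)} ∧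
      n ∈ G ∧ (∀ g ∈ G, n ≤ g) ∧
      ∀ m, m ∈ AddSubsemigroup.closure G ↔ m ∈ S ∧ n ≤ m := by
  classical
  obtain ⟨n, hnS, hn⟩ := hS.exists_gt (M + 2)
  have hTadd : ∀ a b, (a ∈ S ∧ n ≤ a) → (b ∈ S ∧ n ≤ b) → (a + b ∈ S ∧ n ≤ a + b) := by
    rintro a b ⟨ha, ha'⟩ ⟨hb, hb'⟩
    exact ⟨hadd a ha b hb (by omega) (by omega), by omega⟩
  have hTmul : ∀ a, (a ∈ S ∧ n ≤ a) → ∀ k : ℕ, ((k + 1) * a ∈ S ∧ n ≤ (k + 1) * a) := by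
    intro a ha k
    induction k with
    | zero => simpa using ha
    | succ k ih =>
      have := hTadd _ _ ih ha
      rwa [show (k + 1) * a + a = (k + 1 + 1) * a by ring] at this
  let H : AddSubgroup ℤ :=
    { carrier := {z | ∃ t : ℕ, (t ∈ S ∧ n ≤ t) ∧ (n : ℤ) ∣ z - t}
      zero_mem' := ⟨n, ⟨hnS, le_rfl⟩, by simp⟩
      add_mem' := by
        rintro a b ⟨t, ht, hd⟩ ⟨t', ht', hd'⟩
        refine ⟨t + t', hTadd _ _ ht ht', ?_⟩
        have := dvd_add hd hd'
        push_cast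
        rwa [show a + b - ((t : ℤ) + t') = a - t + (b - t') by ring]
      neg_mem' := by
        rintro a ⟨t, ht, hd⟩
        refine ⟨(n - 2 + 1) * t, hTmul t ht _, ?_⟩
        have e : ((n - 2 + 1 : ℕ) : ℤ) = n - 1 := by omega
        rw [Nat.cast_mul, e]
        rw [show -a - ((n : ℤ) - 1) * t = -(a - t) - n * t by ring]
        exact dvd_sub (by simpa using hd.neg_right) (dvd_mul_right _ _) }
  obtain ⟨a, ha⟩ := Int.subgroup_cyclic H
  have hH : ∀ z : ℤ, (∃ t : ℕ, (t ∈ S ∧ n ≤ t) ∧ (n : ℤ) ∣ z - t) ↔ (a.natAbs : ℤ) ∣ z := by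
    intro z
    have : z ∈ H ↔ a ∣ z := by
      rw [ha, ← AddSubgroup.zmultiples_eq_closure, Int.mem_zmultiples_iff]
    rw [Int.natAbs_dvd, ← this]
    rfl
  generalize a.natAbs = p at hH
  have hpn : p ∣ n := by
    have := (hH n).1 ⟨n, ⟨hnS, le_rfl⟩, by simp⟩
    exact_mod_cast this
  obtain ⟨r, hr⟩ := hpn
  have hp : 0 < p := by
    rcases Nat.eq_zero_or_pos p with h | h
    · subst h; omega
    · exact h
  have hr0 : 0 < r := by
    rcases Nat.eq_zero_or_pos r with h | h
    · subst h; omega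
    · exact h
  let G : Set ℕ := {g | (g ∈ S ∧ n ≤ g) ∧ ∀ t, (t ∈ S ∧ n ≤ t) → t % n = g % n → g ≤ t}
  have hrep : ∀ t, (t ∈ S ∧ n ≤ t) → ∃ g ∈ G, g ≤ t ∧ g % n = t % n := by
    intro t ht
    have hex : ∃ g, (g ∈ S ∧ n ≤ g) ∧ g % n = t % n := ⟨t, ht, rfl⟩
    refine ⟨Nat.find hex, ⟨(Nat.find_spec hex).1, ?_⟩, Nat.find_min' hex ⟨ht, rfl⟩,
      (Nat.find_spec hex).2⟩
    intro t' ht' h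
    exact Nat.find_min' hex ⟨ht', h.trans (Nat.find_spec hex).2⟩
  have hnG : n ∈ G := ⟨⟨hnS, le_rfl⟩, fun t ht _ => ht.2⟩
  refine ⟨p, r, n, G, ?_, hp, hr0, hr, by omega, ?_, ?_, hnG, fun g hg => hg.1.2, ?_⟩
  · apply Set.Finite.of_finite_image (f := fun g => g % n)
    · apply (Set.finite_lt_nat n).subset
      rintro _ ⟨g, _, rfl⟩
      exact Nat.mod_lt _ (by omega)
    · intro g hg g' hg' h
      exact le_antisymm (hg.2 _ hg'.1 h.symm) (hg'.2 _ hg.1 h)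
  · intro g hg
    have := hg.1.2
    omega
  · ext x
    simp only [Set.mem_image, Set.mem_setOf_eq]
    constructor
    · rintro ⟨g, hg, rfl⟩
      have : (p : ℤ) ∣ g := (hH g).1 ⟨g, hg.1, by simp⟩
      obtain ⟨q, rfl⟩ : p ∣ g := by exact_mod_cast this
      refine ⟨q % r, ?_, ?_⟩
      · have := Nat.mod_lt q hr0
        omega
      · rw [ZMod.natCast_eq_natCast_iff, hr]
        exact (Nat.ModEq.mul_left' p (Nat.mod_modEq q r)).symm
    · rintro ⟨k, _, rfl⟩
      obtain ⟨t, ht, hd⟩ := (hH ((p * k : ℕ) : ℤ)).2 (by push_cast; exact dvd_mul_right _ _)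
      obtain ⟨g, hg, _, hgt⟩ := hrep t ht
      refine ⟨g, hg, ?_⟩
      rw [ZMod.natCast_eq_natCast_iff]
      have h2 : t ≡ p * k [MOD n] := (Nat.modEq_iff_dvd).2 hd
      exact Nat.ModEq.trans hgt h2
  · intro m
    constructor
    · intro hm
      induction hm using AddSubsemigroup.closure_induction with
      | mem x hx => exact hx.1
      | add x y _ _ hx hy => exact hTadd _ _ hx hy
    · intro hm
      obtain ⟨g, hg, hle, hmod⟩ := hrep m hm
      obtain ⟨k, hk⟩ := (Nat.modEq_iff_dvd' hle).1 hmod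
      have hm' : m = g + n * k := by omega
      rw [hm']
      clear hm' hk hmod hle hm
      induction k with
      | zero => simpa using AddSubsemigroup.subset_closure hg
      | succ k ih =>
        rw [show g + n * (k + 1) = g + n * k + n by ring]
        exact add_mem ih (AddSubsemigroup.subset_closure hnG)

theorem conj_eq {w w' : List Unit} (h : WordConj w w') : w = w' := by
  obtain ⟨x, y, rfl, rfl⟩ := h
  exact unit_ext (by simp [add_comm])

theorem conj_self {A : Type*} (w : List A) : WordConj w w := ⟨w, [], by simp, by simp⟩

theorem circ_step_mem {A : Type*} (I : Set (List A)) (R : Set (CircRule A)) (w : List A)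
    (h : CircStep R (CircLang I R) w) : w ∈ CircLang I R := by
  intro K hK
  obtain ⟨r, hr, x, y, hx, hy, hc⟩ := h
  exact hK.2 w ⟨r, hr, x, y, hx K hK, hy K hK, hc⟩

/-- Characterization of the Păun generated languages over the one-letter alphabet
`{a}` (circular words over a one-letter alphabet being identified with words, i.e.,
with their lengths): `L ⊆ a*` is Păun generated iff either `L` is finite, or
`L = L1 ∪ (a^G)^+` where `L1` is finite, `n = p * r ≥ 2` with `p, r > 0`, `G` is a
finite set of positive integers whose reductions modulo `n` are exactly the subgroup
`G' = {p k : 0 ≤ k ≤ r - 1}` of `ℤ/nℤ`, whose minimum is `n`, and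
`max {ℓ : a^ℓ ∈ L1} < n`. -/
theorem stmt0 (L : Set (List Unit)) :
    (∃ (I : Set (List Unit)) (R : Set (CircRule Unit)),
        I.Finite ∧ R.Finite ∧ L = CircLang I R) ↔
      (L.Finite ∨
        ∃ (L1 : Set (List Unit)) (p r n : ℕ) (G : Set ℕ),
          L1.Finite ∧ G.Finite ∧ 0 < p ∧ 0 < r ∧ n = p * r ∧ 2 ≤ n ∧
          (∀ g ∈ G, 0 < g) ∧
          (fun g : ℕ => (g : ZMod n)) '' G
              = {x : ZMod n | ∃ k : ℕ, k ≤ r - 1 ∧ x = ((p * k : ℕ) : ZMod n)} ∧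
          n ∈ G ∧ (∀ g ∈ G, n ≤ g) ∧
          (∀ w ∈ L1, w.length < n) ∧
          L = L1 ∪ {w : List Unit | w.length ∈ AddSubsemigroup.closure G}) := by
  constructor
  · rintro ⟨I, R, hI, hR, rfl⟩
    by_cases hfin : (CircLang I R).Finite
    · exact Or.inl hfin
    right
    have hRne : R.Nonempty := by
      by_contra hne
      rw [Set.not_nonempty_iff_eq_empty] at hne
      apply hfin
      apply hI.subset
      intro w hw
      apply hw
      refine ⟨?_, ?_⟩
      · intro w hw w' h
        rwa [← conj_eq h]
      · rintro w ⟨r, hr, _⟩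
        simp [hne] at hr
    obtain ⟨ρ, hρ⟩ := hRne
    have hmem : ∀ w : List Unit, ∀ m, w.length = m → List.replicate m () = w := by
      intro w m h
      exact unit_ext (by simp [h])
    obtain ⟨p, r, n, G, hG, hp, hr, hn, hn2, hpos, him, hnG, hmin, hcl⟩ :=
      nat_core {m | List.replicate m () ∈ CircLang I R} (by
        intro hf
        apply hfin
        apply (hf.image (fun m => List.replicate m ())).subset
        intro w hw
        have e := hmem w _ rfl
        exact ⟨w.length, by simpa [e] using hw, e⟩)
        (ρ.u1.length + ρ.u2.length + ρ.u3.length + ρ.u4.length) (by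
        intro a ha b hb hMa hMb
        apply circ_step_mem
        refine ⟨ρ, hρ, List.replicate (a - ρ.u1.length - ρ.u2.length) (),
          List.replicate (b - ρ.u3.length - ρ.u4.length) (), ?_, ?_, ?_⟩
        · rw [← hmem (ρ.u2 ++ _ ++ ρ.u1) a (by simp; omega)]
          exact ha
        · rw [← hmem (ρ.u4 ++ _ ++ ρ.u3) b (by simp; omega)]
          exact hb
        · rw [← hmem (ρ.u2 ++ _ ++ ρ.u1 ++ ρ.u4 ++ _ ++ ρ.u3) (a + b) (by simp; omega)]
          exact conj_self _)
    refine ⟨{w | w ∈ CircLang I R ∧ w.length < n}, p, r, n, G, ?_, hG, hp, hr, hn, hn2, hpos,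
      him, hnG, hmin, fun w hw => hw.2, ?_⟩
    · apply ((Set.finite_lt_nat n).image (fun m => List.replicate m ())).subset
      intro w hw
      exact ⟨w.length, hw.2, hmem w _ rfl⟩
    · ext w
      have := hcl w.length
      rw [Set.mem_setOf_eq, hmem w _ rfl] at this
      simp only [Set.mem_union, Set.mem_setOf_eq, this]
      have := lt_or_ge w.length n
      tauto
  · rintro (hfin | ⟨L1, p, r, n, G, hL1, hG, hp, hr, hn, hn2, hpos, him, hnG, hmin, hlt, rfl⟩)
    · refine ⟨L, ∅, hfin, Set.finite_empty, ?_⟩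
      apply Set.Subset.antisymm
      · intro w hw K hK
        exact hK.1 w hw w (conj_self w)
      · intro w hw
        apply hw
        refine ⟨?_, ?_⟩
        · intro w hw w' h
          rwa [← conj_eq h]
        · rintro w ⟨r, hr, _⟩
          simp at hr
    · have hcl : ∀ m ∈ AddSubsemigroup.closure G, n ≤ m := by
        intro m hm
        induction hm using AddSubsemigroup.closure_induction with
        | mem x hx => exact hmin x hx
        | add x y _ _ hx hy => omega
      refine ⟨L1 ∪ (fun m => List.replicate m ()) '' G,
        {⟨List.replicate n (), [], List.replicate n (), []⟩},
        hL1.union (hG.image _), Set.finite_singleton _, ?_⟩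
      apply Set.Subset.antisymm
      · rintro w (hw | hw) K hK
        · exact hK.1 w (Or.inl hw) w (conj_self w)
        · have key : ∀ m ∈ AddSubsemigroup.closure G, List.replicate m () ∈ K := by
            intro m hm
            induction hm using AddSubsemigroup.closure_induction with
            | mem x hx => exact hK.1 _ (Or.inr ⟨x, hx, rfl⟩) _ (conj_self _)
            | add x y hx' hy' hx hy =>
              have h1 := hcl x hx'
              have h2 := hcl y hy'
              apply hK.2
              refine ⟨_, rfl, List.replicate (x - n) (), List.replicate (y - n) (), ?_, ?_, ?_⟩
              · convert hx using 1
                exact unit_ext (by simp; omega)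
              · convert hy using 1
                exact unit_ext (by simp; omega)
              · convert conj_self _ using 1
                exact unit_ext (by simp; omega)
          have := key _ hw
          rwa [show List.replicate w.length () = w from unit_ext (by simp)] at this
      · intro w hw
        apply hw
        refine ⟨?_, ?_⟩
        · rintro w hw w' h
          rw [← conj_eq h]
          rcases hw with hw | ⟨g, hg, rfl⟩
          · exact Or.inl hw
          · right
            simpa using AddSubsemigroup.subset_closure hg
        · rintro w ⟨ρ, hρ, x, y, hx, hy, hc⟩
          rw [Set.mem_singleton_iff] at hρ
          subst hρ
          have big : ∀ v : List Unit, n ≤ v.length →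
              v ∈ L1 ∪ {w : List Unit | w.length ∈ AddSubsemigroup.closure G} →
              v.length ∈ AddSubsemigroup.closure G := by
            rintro v hv (h | h)
            · have := hlt v h
              omega
            · exact h
          have h1 := big _ (by simp) hx
          have h2 := big _ (by simp) hy
          right
          rw [conj_eq hc]
          have := add_mem h1 h2
          rw [← List.length_append] at this
          simpa [add_assoc] using this
end

section
/- The language generated by an alphabetic context-free flat splicing system is context-free: if S = (A, I, R) is a flat splicing system whose initial set I is a context-free language and in which every handle of every rule is a letter or the empty word, then L(S) is context-free. -/
/-- A flat splicing rule `(α, β, γ, δ)`; its components are called handles. -/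
structure FlatRule (A : Type*) where
  α : List A
  β : List A
  γ : List A
  δ : List A

/-- One flat splicing step: applying the rule `(α,β,γ,δ)` to `u = xαβy` and
`v = γzδ` produces `w = xαγzδβy`. -/
def FlatStep {A : Type*} (R : Set (FlatRule A)) (L : Set (List A)) (w : List A) : Prop :=
  ∃ r ∈ R, ∃ x y z : List A,
    x ++ r.α ++ r.β ++ y ∈ L ∧ r.γ ++ z ++ r.δ ∈ L ∧
    w = x ++ r.α ++ r.γ ++ z ++ r.δ ++ r.β ++ y

/-- The language generated by the flat splicing system `(A, I, R)`: the smallest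
language containing `I` and closed under all productions by rules of `R`. -/
def FlatLang {A : Type*} (I : Set (List A)) (R : Set (FlatRule A)) : Set (List A) :=
  ⋂₀ {L : Set (List A) | I ⊆ L ∧ ∀ w, FlatStep R L w → w ∈ L}

namespace FlatAux

/-- Big-step generation from a sentential form. -/
inductive GenS {T N : Type} (Rl : N → List (Symbol T N) → Prop) :
    List (Symbol T N) → List T → Prop
  | nil : GenS Rl [] []
  | term (t : T) (s : List (Symbol T N)) (w : List T) (h : GenS Rl s w) :
      GenS Rl (Symbol.terminal t :: s) (t :: w)
  | nt (x : N) (o s : List (Symbol T N)) (u v : List T) (hr : Rl x o)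
      (h1 : GenS Rl o u) (h2 : GenS Rl s v) : GenS Rl (Symbol.nonterminal x :: s) (u ++ v)

theorem GenS.append {T N : Type} {Rl : N → List (Symbol T N) → Prop} {a b : List (Symbol T N)}
    {u v : List T} (h1 : GenS Rl a u) (h2 : GenS Rl b v) : GenS Rl (a ++ b) (u ++ v) := by
  induction h1 with
  | nil => simpa using h2
  | term t s w h ih => exact GenS.term t _ _ ih
  | nt x o s u' v' hr h1' h2' ih1 ih2 =>
    have := GenS.nt x o (s ++ b) u' (v' ++ v) hr h1' ih2
    simpa using this

theorem GenS.split {T N : Type} {Rl : N → List (Symbol T N) → Prop} {a b : List (Symbol T N)} :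
    ∀ {w : List T}, GenS Rl (a ++ b) w → ∃ u v, w = u ++ v ∧ GenS Rl a u ∧ GenS Rl b v := by
  induction a with
  | nil => intro w h; exact ⟨[], w, rfl, GenS.nil, h⟩
  | cons x a ih =>
    intro w h
    rw [List.cons_append] at h
    cases h with
    | term t s w h =>
      obtain ⟨u, v, rfl, h1, h2⟩ := ih h
      exact ⟨t :: u, v, rfl, GenS.term _ _ _ h1, h2⟩
    | nt x o s u' v' hr h1 h2 =>
      obtain ⟨u, v, rfl, h3, h4⟩ := ih h2
      exact ⟨u' ++ u, v, by simp, GenS.nt _ _ _ _ _ hr h1 h3, h4⟩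

theorem GenS.terminals {T N : Type} {Rl : N → List (Symbol T N) → Prop} (w : List T) :
    GenS Rl (w.map Symbol.terminal) w := by
  induction w with
  | nil => exact GenS.nil
  | cons t w ih => exact GenS.term _ _ _ ih

theorem derives_iff {T : Type} (g : ContextFreeGrammar T) (s : List (Symbol T g.NT)) (w : List T) :
    g.Derives s (w.map Symbol.terminal) ↔ GenS (fun x o => (⟨x, o⟩ : ContextFreeRule T g.NT) ∈ g.rules) s w := by
  constructor
  · intro h
    induction h using Relation.ReflTransGen.head_induction_on with
    | refl => exact GenS.terminals w
    | head h1 _ ih =>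
      obtain ⟨r, hr, hrw⟩ := h1
      obtain ⟨p, q, rfl, rfl⟩ := hrw.exists_parts
      obtain ⟨u, v, rfl, h1, h2⟩ := ih.split
      obtain ⟨u1, u2, rfl, h3, h4⟩ := h1.split
      refine GenS.append (GenS.append h3 ?_) h2
      have := GenS.nt r.input r.output [] u2 [] (Rl := fun x o => (⟨x, o⟩ : ContextFreeRule T g.NT) ∈ g.rules) hr h4 GenS.nil
      simpa using this
  · intro h
    induction h with
    | nil => exact Relation.ReflTransGen.refl
    | term t s w h ih => exact ih.append_left [Symbol.terminal t]
    | nt x o s u v hr h1 h2 ih1 ih2 =>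
      have e1 : g.Produces (Symbol.nonterminal x :: s) (o ++ s) :=
        ⟨⟨x, o⟩, hr, ContextFreeRule.Rewrites.head s⟩
      refine e1.trans_derives ?_
      rw [List.map_append]
      exact (ih1.append_right s).trans (ih2.append_left _)

theorem isCF_of_finite {T N : Type} [Finite T] [Finite N] (Rl : N → List (Symbol T N) → Prop)
    (k : ℕ) (hk : ∀ x o, Rl x o → o.length ≤ k) (i : N) :
    Language.IsContextFree ({w | GenS Rl [Symbol.nonterminal i] w} : Set (List T)) := by
  have : Finite (Symbol T N) := by
    have e : Function.Injective (fun s : Symbol T N => match s with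
      | .terminal t => (Sum.inl t : T ⊕ N)
      | .nonterminal n => Sum.inr n) := by
      rintro (a | a) (b | b) h <;> simp_all
    exact Finite.of_injective _ e
  have hf : {r : ContextFreeRule T N | Rl r.input r.output}.Finite := by
    have h1 : (Set.univ ×ˢ {l : List (Symbol T N) | l.length ≤ k} : Set (N × List (Symbol T N))).Finite :=
      Set.finite_univ.prod (List.finite_length_le _ k)
    refine (h1.image (fun p => (⟨p.1, p.2⟩ : ContextFreeRule T N))).subset ?_
    intro r hr
    exact ⟨(r.input, r.output), ⟨trivial, hk _ _ hr⟩, rfl⟩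
  refine ⟨⟨N, i, hf.toFinset⟩, ?_⟩
  ext w
  rw [ContextFreeGrammar.mem_language_iff, derives_iff]
  simp only [Set.Finite.mem_toFinset, Set.mem_ofPred_eq]
  rfl

/-- Binary systems. -/
inductive NQ {T Q : Type} (nilQ : Q → Prop) (termQ : Q → T → Q → Prop) (binQ : Q → Q → Q → Prop) :
    Q → List T → Prop
  | nil (s : Q) (h : nilQ s) : NQ nilQ termQ binQ s []
  | term (s : Q) (t : T) (s' : Q) (w : List T) (h : termQ s t s') (h1 : NQ nilQ termQ binQ s' w) :
      NQ nilQ termQ binQ s (t :: w)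
  | bin (s s1 s2 : Q) (u v : List T) (h : binQ s s1 s2) (h1 : NQ nilQ termQ binQ s1 u)
      (h2 : NQ nilQ termQ binQ s2 v) : NQ nilQ termQ binQ s (u ++ v)

theorem exists_NQ {T : Type} (I : Language T) (hI : I.IsContextFree) :
    ∃ (Q : Type) (_ : Finite Q) (nilQ : Q → Prop) (termQ : Q → T → Q → Prop)
      (binQ : Q → Q → Q → Prop) (i : Q), ∀ w, w ∈ I ↔ NQ nilQ termQ binQ i w := by
  obtain ⟨g, rfl⟩ := hI
  let S : Set (List (Symbol T g.NT)) :=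
    {l | l <:+ [Symbol.nonterminal g.initial] ∨ ∃ r ∈ g.rules, l <:+ r.output}
  have hS : S.Finite := by
    have h1 : ∀ m : List (Symbol T g.NT), {l | l <:+ m}.Finite := by
      intro m
      refine (List.finite_toSet m.tails).subset ?_
      intro l hl
      simpa using hl
    have h2 : (⋃ r ∈ g.rules, {l | l <:+ r.output}).Finite :=
      Set.Finite.biUnion (Finset.finite_toSet g.rules) (fun r _ => h1 _)
    refine ((h1 [Symbol.nonterminal g.initial]).union h2).subset ?_
    rintro l (hl | ⟨r, hr, hl⟩)
    · exact Or.inl hl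
    · right
      simp only [Set.mem_iUnion]
      exact ⟨r, hr, hl⟩
  have hcons : ∀ x l, x :: l ∈ S → l ∈ S := by
    rintro x l (h | ⟨r, hr, h⟩)
    · exact Or.inl ((List.suffix_cons x l).trans h)
    · exact Or.inr ⟨r, hr, (List.suffix_cons x l).trans h⟩
  have hi : [Symbol.nonterminal g.initial] ∈ S := Or.inl (List.suffix_refl _)
  refine ⟨S, hS, fun s => s.1 = [], fun s t s' => s.1 = Symbol.terminal t :: s'.1,
    fun s s1 s2 => ∃ x, s.1 = Symbol.nonterminal x :: s2.1 ∧
      (⟨x, s1.1⟩ : ContextFreeRule T g.NT) ∈ g.rules, ⟨_, hi⟩, ?_⟩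
  intro w
  rw [ContextFreeGrammar.mem_language_iff, derives_iff]
  constructor
  · intro h
    have key : ∀ s w, GenS (fun x o => (⟨x, o⟩ : ContextFreeRule T g.NT) ∈ g.rules) s w →
        ∀ hs : s ∈ S, NQ (fun s : S => s.1 = []) (fun s t s' => s.1 = Symbol.terminal t :: s'.1)
          (fun s s1 s2 => ∃ x, s.1 = Symbol.nonterminal x :: s2.1 ∧
            (⟨x, s1.1⟩ : ContextFreeRule T g.NT) ∈ g.rules) ⟨s, hs⟩ w := by
      intro s w h
      induction h with
      | nil => intro hs; exact NQ.nil _ rfl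
      | term t s w h ih =>
        intro hs
        exact NQ.term _ t ⟨s, hcons _ _ hs⟩ w rfl (ih _)
      | nt x o s u v hr h1 h2 ih1 ih2 =>
        intro hs
        have ho : o ∈ S := Or.inr ⟨_, hr, List.suffix_refl _⟩
        exact NQ.bin _ ⟨o, ho⟩ ⟨s, hcons _ _ hs⟩ u v ⟨x, rfl, hr⟩ (ih1 _) (ih2 _)
    exact key _ _ h hi
  · intro h
    have key : ∀ (s : S) w, NQ (fun s : S => s.1 = []) (fun s t s' => s.1 = Symbol.terminal t :: s'.1)
          (fun s s1 s2 => ∃ x, s.1 = Symbol.nonterminal x :: s2.1 ∧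
            (⟨x, s1.1⟩ : ContextFreeRule T g.NT) ∈ g.rules) s w →
        GenS (fun x o => (⟨x, o⟩ : ContextFreeRule T g.NT) ∈ g.rules) s.1 w := by
      intro s w h
      induction h with
      | nil s h => rw [h]; exact GenS.nil
      | term s t s' w h h1 ih => rw [h]; exact GenS.term _ _ _ ih
      | bin s s1 s2 u v h h1 h2 ih1 ih2 =>
        obtain ⟨x, hx, hr⟩ := h
        rw [hx]
        exact GenS.nt _ _ _ _ _ hr ih1 ih2
    exact key _ _ h

/-- `v` may be inserted in a gap with left neighbour `l` and right neighbour `r`. -/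
def Good {A : Type} (R : Set (FlatRule A)) (l : Option A) (v : List A) (r : Option A) : Prop :=
  v ≠ [] ∧ ∃ ρ ∈ R, ρ.α <:+ l.toList ∧ ρ.β <+: r.toList ∧ ∃ z, v = ρ.γ ++ z ++ ρ.δ

inductive NT (A Q : Type)
  | W (p : Option A) (s : Q) (q : Option A)
  | F (p b : Option A)
  | L

inductive D {A Q : Type} (R : Set (FlatRule A)) (nilQ : Q → Prop) (termQ : Q → A → Q → Prop)
    (binQ : Q → Q → Q → Prop) (i : Q) : NT A Q → List A → Prop
  | wnil (p : Option A) (s : Q) (h : nilQ s) : D R nilQ termQ binQ i (NT.W p s p) []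
  | wterm (p q : Option A) (s s' : Q) (t : A) (f w : List A) (h : termQ s t s')
      (h1 : D R nilQ termQ binQ i (NT.F p (some t)) f)
      (h2 : D R nilQ termQ binQ i (NT.W (some t) s' q) w) :
      D R nilQ termQ binQ i (NT.W p s q) (f ++ t :: w)
  | wbin (p p' q : Option A) (s s1 s2 : Q) (u w : List A) (h : binQ s s1 s2)
      (h1 : D R nilQ termQ binQ i (NT.W p s1 p') u)
      (h2 : D R nilQ termQ binQ i (NT.W p' s2 q) w) :
      D R nilQ termQ binQ i (NT.W p s q) (u ++ w)
  | fnil (p b : Option A) : D R nilQ termQ binQ i (NT.F p b) []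
  | fins (p b : Option A) (f v f' : List A) (h : Good R p v b)
      (h1 : D R nilQ termQ binQ i (NT.F p v.head?) f)
      (h2 : D R nilQ termQ binQ i NT.L v)
      (h3 : D R nilQ termQ binQ i (NT.F v.getLast? b) f') :
      D R nilQ termQ binQ i (NT.F p b) (f ++ (v ++ f'))
  | lmk (q : Option A) (w f : List A)
      (h1 : D R nilQ termQ binQ i (NT.W none i q) w)
      (h2 : D R nilQ termQ binQ i (NT.F q none) f) :
      D R nilQ termQ binQ i NT.L (w ++ f)

/-- Class of a word. -/
def cls {A : Type} (w : List A) : Option A × Option A × Bool :=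
  (w.head?, w.getLast?, decide (2 ≤ w.length))

theorem cls_append {A : Type} {u v u' v' : List A} (h1 : cls u = cls u') (h2 : cls v = cls v') :
    cls (u ++ v) = cls (u' ++ v') := by
  simp only [cls, Prod.mk.injEq, decide_eq_decide] at *
  obtain ⟨a1, a2, a3⟩ := h1
  obtain ⟨b1, b2, b3⟩ := h2
  refine ⟨by simp [a1, b1], by simp [a2, b2], ?_⟩
  have e1 : u.length = 0 ↔ u'.length = 0 := by
    rw [List.length_eq_zero_iff, List.length_eq_zero_iff, ← List.head?_eq_none_iff, a1,
      List.head?_eq_none_iff]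
  have e2 : v.length = 0 ↔ v'.length = 0 := by
    rw [List.length_eq_zero_iff, List.length_eq_zero_iff, ← List.head?_eq_none_iff, b1,
      List.head?_eq_none_iff]
  simp only [List.length_append]
  omega

theorem cls_match {A : Type} {v v' c d z : List A} (hc : c.length ≤ 1) (hd : d.length ≤ 1)
    (h : cls v = cls v') (hv : v = c ++ z ++ d) : ∃ z', v' = c ++ z' ++ d := by
  simp only [cls, Prod.mk.injEq, decide_eq_decide] at h
  obtain ⟨a1, a2, a3⟩ := h
  subst hv
  match c, d, hc, hd with
  | [], [], _, _ => exact ⟨v', by simp⟩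
  | [a], [], _, _ =>
    cases v' with
    | nil => simp at a1
    | cons x t => simp at a1; exact ⟨t, by simp [a1]⟩
  | [], [b], _, _ =>
    rcases List.eq_nil_or_concat' v' with rfl | ⟨t, x, rfl⟩
    · simp at a2
    · simp at a2; exact ⟨t, by simp [a2]⟩
  | [a], [b], _, _ =>
    have h2 : 2 ≤ v'.length := by rw [← a3]; simp
    cases v' with
    | nil => simp at h2
    | cons x t =>
      rcases List.eq_nil_or_concat' t with rfl | ⟨t, y, rfl⟩
      · simp at h2
      · rw [← List.cons_append, List.getLast?_concat, List.getLast?_concat] at a2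
        simp at a1 a2; exact ⟨t, by simp [a1, a2]⟩

theorem cls_ne_nil {A : Type} {v v' : List A} (h : cls v = cls v') (hv : v ≠ []) : v' ≠ [] := by
  rintro rfl
  simp only [cls, Prod.mk.injEq] at h
  exact hv (by simpa using h.1)

theorem Good.congr {A : Type} {R : Set (FlatRule A)}
    (halph : ∀ r ∈ R,
      r.α.length ≤ 1 ∧ r.β.length ≤ 1 ∧ r.γ.length ≤ 1 ∧ r.δ.length ≤ 1)
    {l r : Option A} {v v' : List A} (h : cls v = cls v') (hg : Good R l v r) : Good R l v' r := by
  obtain ⟨hv, ρ, hρ, h1, h2, z, hz⟩ := hg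
  exact ⟨cls_ne_nil h hv, ρ, hρ, h1, h2,
    cls_match (halph ρ hρ).2.2.1 (halph ρ hρ).2.2.2 h hz⟩

section ins
variable {A Q : Type} {R : Set (FlatRule A)} {nilQ : Q → Prop} {termQ : Q → A → Q → Prop}
  {binQ : Q → Q → Q → Prop} {i : Q}

theorem getLast?_mid (f w : List A) (t : A) (p : Option A) :
    (f ++ t :: w).getLast?.or p = w.getLast?.or (some t) := by
  have : f ++ t :: w = (f ++ [t]) ++ w := by simp
  rw [this, List.getLast?_append, List.getLast?_concat]
  cases w.getLast? <;> simp

theorem W_last {X : NT A Q} {w : List A} (h : D R nilQ termQ binQ i X w) :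
    ∀ p s q, X = NT.W p s q → w.getLast?.or p = q := by
  induction h with
  | wnil p s h => intro p s q e; cases e; rfl
  | wterm p q s s' t f w h h1 h2 ih1 ih2 =>
    intro p s q e; cases e
    have := ih2 _ _ _ rfl
    rw [← this, getLast?_mid]
  | wbin p p' q s s1 s2 u w h h1 h2 ih1 ih2 =>
    intro p s q e; cases e
    rw [← ih2 _ _ _ rfl, ← ih1 _ _ _ rfl]
    simp [Option.or_assoc]
  | _ => intro p s q e; cases e

def InsM (R : Set (FlatRule A)) (nilQ : Q → Prop) (termQ : Q → A → Q → Prop)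
    (binQ : Q → Q → Q → Prop) (i : Q) (v : List A) : NT A Q → List A → Prop
  | NT.W p s q, w => ∀ w1 w2, w = w1 ++ w2 → w2 ≠ [] → Good R (w1.getLast?.or p) v w2.head? →
      D R nilQ termQ binQ i (NT.W p s q) (w1 ++ (v ++ w2))
  | NT.F p b, w => ∀ w1 w2, w = w1 ++ w2 → Good R (w1.getLast?.or p) v (w2.head?.or b) →
      D R nilQ termQ binQ i (NT.F p b) (w1 ++ (v ++ w2))
  | NT.L, w => ∀ w1 w2, w = w1 ++ w2 → Good R w1.getLast? v w2.head? →
      D R nilQ termQ binQ i NT.L (w1 ++ (v ++ w2))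

/-- splitting an append -/
theorem append_cases {u w w1 w2 : List A} (h : u ++ w = w1 ++ w2) :
    (∃ c, c ≠ [] ∧ u = w1 ++ c ∧ w2 = c ++ w) ∨ (∃ c, w1 = u ++ c ∧ w = c ++ w2) := by
  rcases List.append_eq_append_iff.1 h with ⟨c, h1, h2⟩ | ⟨c, h1, h2⟩
  · exact Or.inr ⟨c, h1, h2⟩
  · by_cases hc : c = []
    · subst hc; right; exact ⟨[], by simp_all, by simp_all⟩
    · exact Or.inl ⟨c, hc, h1, h2⟩

theorem head?_append_ne {c w : List A} (hc : c ≠ []) : (c ++ w).head? = c.head? := by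
  cases c <;> simp_all

theorem getLast?_append_ne {c w : List A} (hc : c ≠ []) : (w ++ c).getLast? = c.getLast? := by
  cases c using List.reverseRecOn <;> simp_all [← List.append_assoc]

theorem insert_all (halph : ∀ r ∈ R,
      r.α.length ≤ 1 ∧ r.β.length ≤ 1 ∧ r.γ.length ≤ 1 ∧ r.δ.length ≤ 1) {v : List A}
    (hv : D R nilQ termQ binQ i NT.L v) {X : NT A Q} {w : List A}
    (h : D R nilQ termQ binQ i X w) : InsM R nilQ termQ binQ i v X w := by
  induction h with
  | wnil p s h =>
    intro w1 w2 e hne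
    simp at e
    exact absurd e.2 hne
  | wterm p q s s' t f w h h1 h2 ih1 ih2 =>
    intro w1 w2 e hne hg
    rcases append_cases e with ⟨c, hc, rfl, rfl⟩ | ⟨c, rfl, e2⟩
    · have := ih1 w1 c rfl (by
        rw [head?_append_ne hc] at hg
        cases c <;> simp_all)
      have := D.wterm p q s s' t _ w h this h2
      simpa using this
    · cases c with
      | nil =>
        simp at e2; subst e2
        have := ih1 f [] (by simp) (by simpa using hg)
        have := D.wterm p q s s' t _ w h this h2
        simpa using this
      | cons x c =>
        simp at e2
        obtain ⟨rfl, rfl⟩ := e2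
        have := ih2 c w2 rfl hne (by
          rwa [getLast?_mid] at hg)
        have := D.wterm p q s s' t f _ h h1 this
        simpa using this
  | wbin p p' q s s1 s2 u w h h1 h2 ih1 ih2 =>
    intro w1 w2 e hne hg
    rcases append_cases e with ⟨c, hc, rfl, rfl⟩ | ⟨c, rfl, rfl⟩
    · rw [head?_append_ne hc] at hg
      have := D.wbin p p' q s s1 s2 _ w h (ih1 w1 c rfl hc hg) h2
      simpa using this
    · have hl := W_last h1 _ _ _ rfl
      have := D.wbin p p' q s s1 s2 u _ h h1 (ih2 c w2 rfl hne (by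
        simpa [← hl, Option.or_assoc] using hg))
      simpa using this
  | fnil p b =>
    intro w1 w2 e hg
    simp at e
    obtain ⟨rfl, rfl⟩ := e
    have := D.fins p b [] v [] (by simpa using hg) (D.fnil _ _) hv (D.fnil _ _)
    simpa using this
  | fins p b f v' f' h h1 h2 h3 ih1 ih2 ih3 =>
    intro w1 w2 e hg
    rcases append_cases e with ⟨c, hc, rfl, rfl⟩ | ⟨c, rfl, e2⟩
    · rw [head?_append_ne hc] at hg
      have := D.fins p b _ v' f' h (ih1 w1 c rfl (by cases c <;> simp_all)) h2 h3
      simpa using this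
    · by_cases hc : c = []
      · subst hc
        simp at e2; subst e2
        have := D.fins p b _ v' f' h (ih1 f [] (by simp) (by
          have := h.1
          cases v' <;> simp_all)) h2 h3
        simpa using this
      · rcases append_cases e2 with ⟨d, hd, rfl, rfl⟩ | ⟨d, rfl, rfl⟩
        · have hg' : Good R c.getLast? v d.head? := by
            rw [head?_append_ne hd, getLast?_append_ne hc] at hg
            cases c using List.reverseRecOn <;> cases d <;> simp_all
          have h2' := ih2 c d rfl hg'
          have hcls : cls (c ++ d) = cls (c ++ (v ++ d)) := by
            have e1 : (c ++ (v ++ d)).getLast? = d.getLast? := by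
              rw [← List.append_assoc, getLast?_append_ne hd]
            simp only [cls, head?_append_ne hc, getLast?_append_ne hd, e1, Prod.mk.injEq,
              decide_eq_decide, true_and, List.length_append]
            have := List.length_pos_iff.2 hc
            have := List.length_pos_iff.2 hd
            omega
          have hh : (c ++ d).head? = (c ++ (v ++ d)).head? := congrArg Prod.fst hcls
          have hh2 : (c ++ d).getLast? = (c ++ (v ++ d)).getLast? :=
            congrArg (fun x => x.2.1) hcls
          have := D.fins p b f (c ++ (v ++ d)) f' (h.congr halph hcls) (hh ▸ h1) h2' (hh2 ▸ h3)
          simpa using this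
        · have := D.fins p b f v' _ h h1 h2 (ih3 d w2 rfl (by
            have h5 := h.1
            rw [← List.append_assoc] at hg
            cases d using List.reverseRecOn with
            | nil => 
              rw [List.append_nil, getLast?_append_ne h5] at hg
              cases v' using List.reverseRecOn <;> simp_all
            | append_singleton d x => simpa [← List.append_assoc] using hg))
          simpa using this
  | lmk q w f h1 h2 ih1 ih2 =>
    intro w1 w2 e hg
    rcases append_cases e with ⟨c, hc, rfl, rfl⟩ | ⟨c, rfl, rfl⟩
    · rw [head?_append_ne hc] at hg
      have := D.lmk q _ f (ih1 w1 c rfl hc (by simpa using hg)) h2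
      simpa using this
    · have hl := W_last h1 _ _ _ rfl
      have := D.lmk q w _ h1 (ih2 c w2 rfl (by
        simpa [← hl, Option.or_assoc] using hg))
      simpa using this

theorem D_of_NQ {s : Q} {w : List A} (h : NQ nilQ termQ binQ s w) :
    ∀ p, ∃ q, D R nilQ termQ binQ i (NT.W p s q) w := by
  induction h with
  | nil s h => intro p; exact ⟨p, D.wnil _ _ h⟩
  | term s t s' w h h1 ih =>
    intro p
    obtain ⟨q, hq⟩ := ih (some t)
    exact ⟨q, D.wterm p q s s' t [] w h (D.fnil _ _) hq⟩
  | bin s s1 s2 u v h h1 h2 ih1 ih2 =>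
    intro p
    obtain ⟨p', hp⟩ := ih1 p
    obtain ⟨q, hq⟩ := ih2 p'
    exact ⟨q, D.wbin _ _ _ _ _ _ _ _ h hp hq⟩

def SndM (K : Set (List A)) (nilQ : Q → Prop) (termQ : Q → A → Q → Prop)
    (binQ : Q → Q → Q → Prop) : NT A Q → List A → Prop
  | NT.W p s _, w => ∃ u, NQ nilQ termQ binQ s u ∧ ∀ x y, x.getLast? = p →
      x ++ (u ++ y) ∈ K → x ++ (w ++ y) ∈ K
  | NT.F p b, w => ∀ x y, x.getLast? = p → y.head? = b → x ++ y ∈ K → x ++ (w ++ y) ∈ K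
  | NT.L, w => w ∈ K

theorem sound {K : Set (List A)} (hI : ∀ w, NQ nilQ termQ binQ i w → w ∈ K)
    (hK : ∀ w, FlatStep R K w → w ∈ K) {X : NT A Q} {w : List A}
    (h : D R nilQ termQ binQ i X w) : SndM K nilQ termQ binQ X w := by
  induction h with
  | wnil p s h => exact ⟨[], NQ.nil _ h, fun x y _ h => h⟩
  | wterm p q s s' t f w h h1 h2 ih1 ih2 =>
    obtain ⟨u, hu, H⟩ := ih2
    refine ⟨t :: u, NQ.term _ _ _ _ h hu, fun x y hx hm => ?_⟩
    have a1 := ih1 x (t :: u ++ y) hx rfl hm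
    have a2 := H (x ++ f ++ [t]) y (by simp [← List.append_assoc]) (by simpa using a1)
    simpa using a2
  | wbin p p' q s s1 s2 u w h h1 h2 ih1 ih2 =>
    obtain ⟨u1, hu1, H1⟩ := ih1
    obtain ⟨u2, hu2, H2⟩ := ih2
    refine ⟨u1 ++ u2, NQ.bin _ _ _ _ _ h hu1 hu2, fun x y hx hm => ?_⟩
    have a1 := H1 x (u2 ++ y) hx (by simpa using hm)
    have a2 := H2 (x ++ u) y (by
      rw [← W_last h1 _ _ _ rfl, ← hx]; simp) (by simpa using a1)
    simpa using a2
  | fnil p b => intro x y _ _ h; exact h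
  | fins p b f v f' h h1 h2 h3 ih1 ih2 ih3 =>
    intro x y hx hy hm
    have a0 : x ++ (v ++ y) ∈ K := by
      obtain ⟨_, ρ, hρ, ha, hb, z, rfl⟩ := h
      have hx' : ρ.α <:+ x := by
        refine ha.trans ?_
        subst hx
        cases x using List.reverseRecOn <;> simp
      have hy' : ρ.β <+: y := by
        refine hb.trans ?_
        subst hy
        cases y <;> simp
      obtain ⟨x', rfl⟩ := hx'
      obtain ⟨y', rfl⟩ := hy'
      exact hK _ ⟨ρ, hρ, x', y', z, by simpa using hm, ih2, by simp⟩
    have a1 := ih1 x (v ++ y) hx (head?_append_ne h.1) a0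
    have a2 := ih3 (x ++ f ++ v) y (getLast?_append_ne h.1) hy (by simpa using a1)
    simpa using a2
  | lmk q w f h1 h2 ih1 ih2 =>
    obtain ⟨u, hu, H⟩ := ih1
    have a1 := H [] [] rfl (by simpa using hI _ hu)
    have a2 := ih2 w [] (by simpa using W_last h1 _ _ _ rfl) rfl (by simpa using a1)
    simpa [SndM] using a2

theorem D_iff (halph : ∀ r ∈ R,
      r.α.length ≤ 1 ∧ r.β.length ≤ 1 ∧ r.γ.length ≤ 1 ∧ r.δ.length ≤ 1)
    {I : Set (List A)} (hI : ∀ w, w ∈ I ↔ NQ nilQ termQ binQ i w) (w : List A) :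
    w ∈ FlatLang I R ↔ D R nilQ termQ binQ i NT.L w := by
  constructor
  · intro h
    refine h {w | D R nilQ termQ binQ i NT.L w} ⟨?_, ?_⟩
    · intro w hw
      obtain ⟨q, hq⟩ := D_of_NQ (R := R) (i := i) ((hI w).1 hw) none
      have := D.lmk q w [] hq (D.fnil _ _)
      simpa using this
    · rintro w ⟨ρ, hρ, x, y, z, h1, h2, rfl⟩
      by_cases hv : ρ.γ ++ z ++ ρ.δ = []
      · simp at hv
        simpa [hv] using h1
      · have := insert_all halph h2 h1 (x ++ ρ.α) (ρ.β ++ y) (by simp) ⟨hv, ρ, hρ, ?_, ?_, z, rfl⟩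
        · simpa using this
        · have := (halph ρ hρ).1
          match ρ.α, this with
          | [], _ => simp
          | [a], _ => simp
        · have := (halph ρ hρ).2.1
          match ρ.β, this with
          | [], _ => simp
          | [a], _ => simp
  · intro h K ⟨hK1, hK2⟩
    exact sound (fun w hw => hK1 ((hI w).2 hw)) hK2 h

abbrev GN (A Q : Type) := Option (NT A Q × (Option A × Option A × Bool))

inductive GR (R : Set (FlatRule A)) (nilQ : Q → Prop) (termQ : Q → A → Q → Prop)
    (binQ : Q → Q → Q → Prop) (i : Q) : GN A Q → List (Symbol A (GN A Q)) → Prop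
  | start (m : Option A × Option A × Bool) :
      GR R nilQ termQ binQ i none [.nonterminal (some (NT.L, m))]
  | wnil (p : Option A) (s : Q) (h : nilQ s) :
      GR R nilQ termQ binQ i (some (NT.W p s p, cls [])) []
  | wterm (p q : Option A) (s s' : Q) (t : A) (f w : List A) (h : termQ s t s') :
      GR R nilQ termQ binQ i (some (NT.W p s q, cls (f ++ t :: w)))
        [.nonterminal (some (NT.F p (some t), cls f)), .terminal t,
          .nonterminal (some (NT.W (some t) s' q, cls w))]
  | wbin (p p' q : Option A) (s s1 s2 : Q) (u w : List A) (h : binQ s s1 s2) :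
      GR R nilQ termQ binQ i (some (NT.W p s q, cls (u ++ w)))
        [.nonterminal (some (NT.W p s1 p', cls u)), .nonterminal (some (NT.W p' s2 q, cls w))]
  | fnil (p b : Option A) : GR R nilQ termQ binQ i (some (NT.F p b, cls [])) []
  | fins (p b : Option A) (f v f' : List A) (h : Good R p v b) :
      GR R nilQ termQ binQ i (some (NT.F p b, cls (f ++ (v ++ f'))))
        [.nonterminal (some (NT.F p v.head?, cls f)), .nonterminal (some (NT.L, cls v)),
          .nonterminal (some (NT.F v.getLast? b, cls f'))]
  | lmk (q : Option A) (w f : List A) :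
      GR R nilQ termQ binQ i (some (NT.L, cls (w ++ f)))
        [.nonterminal (some (NT.W none i q, cls w)), .nonterminal (some (NT.F q none, cls f))]

def Interp {T N : Type} (P : N → List T → Prop) : List (Symbol T N) → List T → Prop
  | [], w => w = []
  | .terminal t :: s, w => ∃ w', w = t :: w' ∧ Interp P s w'
  | .nonterminal x :: s, w => ∃ u v, w = u ++ v ∧ P x u ∧ Interp P s v

theorem GenS.interp {T N : Type} {Rl : N → List (Symbol T N) → Prop} {P : N → List T → Prop}
    (hP : ∀ x o w, Rl x o → Interp P o w → P x w) {s : List (Symbol T N)} {w : List T}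
    (h : GenS Rl s w) : Interp P s w := by
  induction h with
  | nil => rfl
  | term t s w h ih => exact ⟨w, rfl, ih⟩
  | nt x o s u v hr h1 h2 ih1 ih2 => exact ⟨u, v, rfl, hP _ _ _ hr ih1, ih2⟩

def GP (R : Set (FlatRule A)) (nilQ : Q → Prop) (termQ : Q → A → Q → Prop)
    (binQ : Q → Q → Q → Prop) (i : Q) : GN A Q → List A → Prop
  | none, w => D R nilQ termQ binQ i NT.L w
  | some (X, m), w => D R nilQ termQ binQ i X w ∧ cls w = m

theorem GR_sound (halph : ∀ r ∈ R,
      r.α.length ≤ 1 ∧ r.β.length ≤ 1 ∧ r.γ.length ≤ 1 ∧ r.δ.length ≤ 1)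
    (x : GN A Q) (o : List (Symbol A (GN A Q))) (w : List A)
    (h : GR R nilQ termQ binQ i x o) (hw : Interp (GP R nilQ termQ binQ i) o w) :
    GP R nilQ termQ binQ i x w := by
  cases h with
  | start m =>
    obtain ⟨u, v, rfl, h1, rfl⟩ := hw
    simpa [GP] using h1.1
  | wnil p s h => cases hw; exact ⟨D.wnil _ _ h, rfl⟩
  | wterm p q s s' t f w h =>
    obtain ⟨u, v, rfl, h1, v', rfl, v2, v3, rfl, h2, rfl⟩ := hw
    rw [List.append_nil]
    exact ⟨D.wterm _ _ _ _ _ _ _ h h1.1 h2.1,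
      cls_append h1.2 (cls_append (u := [t]) (u' := [t]) rfl h2.2)⟩
  | wbin p p' q s s1 s2 u w h =>
    obtain ⟨u, v, rfl, h1, v2, v3, rfl, h2, rfl⟩ := hw
    rw [List.append_nil]
    exact ⟨D.wbin _ _ _ _ _ _ _ _ h h1.1 h2.1, cls_append h1.2 h2.2⟩
  | fnil p b => cases hw; exact ⟨D.fnil _ _, rfl⟩
  | fins p b f v f' h =>
    obtain ⟨u, _, rfl, h1, v2, _, rfl, h2, v3, _, rfl, h3, rfl⟩ := hw
    rw [List.append_nil]
    have e1 : v.head? = v2.head? := (congrArg Prod.fst h2.2).symm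
    have e2 : v.getLast? = v2.getLast? := (congrArg (fun x => x.2.1) h2.2).symm
    exact ⟨D.fins _ _ _ _ _ (h.congr halph h2.2.symm) (e1 ▸ h1.1) h2.1 (e2 ▸ h3.1),
      cls_append h1.2 (cls_append h2.2 h3.2)⟩
  | lmk q w f =>
    obtain ⟨u, v, rfl, h1, v2, v3, rfl, h2, rfl⟩ := hw
    rw [List.append_nil]
    exact ⟨D.lmk _ _ _ h1.1 h2.1, cls_append h1.2 h2.2⟩

theorem GenS.rule {T N : Type} {Rl : N → List (Symbol T N) → Prop} {x : N}
    {o : List (Symbol T N)} {w : List T} (hr : Rl x o) (h : GenS Rl o w) :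
    GenS Rl [.nonterminal x] w := by
  simpa using GenS.nt x o [] w [] hr h GenS.nil

theorem GR_complete {X : NT A Q} {w : List A} (h : D R nilQ termQ binQ i X w) :
    GenS (GR R nilQ termQ binQ i) [.nonterminal (some (X, cls w))] w := by
  induction h with
  | wnil p s h => exact GenS.rule (GR.wnil _ _ h) GenS.nil
  | wterm p q s s' t f w h h1 h2 ih1 ih2 =>
    exact GenS.rule (GR.wterm _ _ _ _ _ _ _ h) (ih1.append (GenS.term t _ _ ih2))
  | wbin p p' q s s1 s2 u w h h1 h2 ih1 ih2 =>
    exact GenS.rule (GR.wbin _ _ _ _ _ _ _ _ h) (ih1.append ih2)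
  | fnil p b => exact GenS.rule (GR.fnil _ _) GenS.nil
  | fins p b f v f' h h1 h2 h3 ih1 ih2 ih3 =>
    exact GenS.rule (GR.fins _ _ _ _ _ h) (ih1.append (ih2.append ih3))
  | lmk q w f h1 h2 ih1 ih2 => exact GenS.rule (GR.lmk _ _ _) (ih1.append ih2)

theorem finite_NT [Finite A] [Finite Q] : Finite (NT A Q) := by
  have e : Function.Injective (fun s : NT A Q => match s with
      | .W p s q => (some (Sum.inl (p, s, q)) : Option ((Option A × Q × Option A) ⊕ (Option A × Option A)))
      | .F p b => some (Sum.inr (p, b))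
      | .L => none) := by
    rintro (_ | _ | _) (_ | _ | _) h <;> simp_all
  exact Finite.of_injective _ e

end ins

end FlatAux

/-- The language generated by an alphabetic context-free flat splicing system is
context-free: if the initial set is context-free and every handle of every rule is a
letter or the empty word, then the generated language is context-free. -/
theorem stmt3 {A : Type} [Fintype A] (I : Language A) (R : Set (FlatRule A))
    (hR : R.Finite) (hI : I.IsContextFree)
    (halph : ∀ r ∈ R,
      r.α.length ≤ 1 ∧ r.β.length ≤ 1 ∧ r.γ.length ≤ 1 ∧ r.δ.length ≤ 1) :
    Language.IsContextFree (FlatLang I R : Language A) := by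
  obtain ⟨Q, _, nilQ, termQ, binQ, i, hQ⟩ := FlatAux.exists_NQ I hI
  have := FlatAux.finite_NT (A := A) (Q := Q)
  have key := FlatAux.isCF_of_finite (FlatAux.GR R nilQ termQ binQ i) 3
    (by intro x o h; cases h <;> simp) none
  have e : (FlatLang I R : Set (List A)) =
      {w | FlatAux.GenS (FlatAux.GR R nilQ termQ binQ i) [Symbol.nonterminal none] w} := by
    ext w
    rw [FlatAux.D_iff halph hQ w]
    constructor
    · intro h
      exact FlatAux.GenS.rule (FlatAux.GR.start _) (FlatAux.GR_complete h)
    · intro h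
      obtain ⟨u, v, rfl, h1, rfl⟩ := FlatAux.GenS.interp (FlatAux.GR_sound halph) h
      rw [List.append_nil]
      exact h1
  rw [e]
  exact key
end

section
/- The language generated by an alphabetic context-free circular splicing system is context-free: if S = (A, I, R) is a Păun circular splicing system whose initial circular language I is context-free and in which every component u1, u2, u3, u4 of every rule u1#u2$u3#u4 is a letter or the empty word, then the circular language L(S) is context-free, i.e., its full linearization Lin(L(S)) is a context-free language. -/
namespace Spl

variable {A : Type}

abbrev Ty (A : Type) := Option (A × A × Bool)

def ty : List A → Ty A
  | [] => none
  | a :: l => some (a, (a :: l).getLast (by simp), l.isEmpty)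

def mul : Ty A → Ty A → Ty A
  | none, x => x
  | x, none => x
  | some (a, _, _), some (_, d, _) => some (a, d, false)

@[simp] lemma mul_none (x : Ty A) : mul x none = x := by cases x <;> rfl
@[simp] lemma none_mul (x : Ty A) : mul none x = x := by cases x <;> rfl

lemma mul_assoc' (x y z : Ty A) : mul (mul x y) z = mul x (mul y z) := by
  rcases x with _ | ⟨a, b, c⟩ <;> rcases y with _ | ⟨a, b, c⟩ <;>
    rcases z with _ | ⟨a, b, c⟩ <;> rfl

@[simp] lemma ty_nil : ty ([] : List A) = none := rfl

lemma ty_append (u v : List A) : ty (u ++ v) = mul (ty u) (ty v) := by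
  rcases u with _ | ⟨a, u⟩
  · simp
  · rcases v with _ | ⟨b, v⟩
    · simp
    · simp [ty, mul, List.getLast_append]

lemma ty_iff {w : List A} {c d : A} {s : Bool} :
    ty w = some (c, d, s) ↔ w.head? = some c ∧ w.getLast? = some d ∧ (s = true ↔ w.length = 1) := by
  rcases w with _ | ⟨a, w⟩
  · simp
  · simp only [ty, Option.some.injEq, Prod.mk.injEq, List.head?_cons, List.getLast?_eq_some_getLast (List.cons_ne_nil a w)]
    cases s <;> cases w <;> simp

lemma ty_of_ne {w : List A} (h : w ≠ []) : ∃ c d s, ty w = some (c, d, s) := by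
  cases w with
  | nil => simp at h
  | cons a l => exact ⟨_, _, _, rfl⟩

lemma ty_ne {w : List A} {t} (h : ty w = some t) : w ≠ [] := by
  rintro rfl; simp at h

def EndsT (c d : A) (s : Bool) (u v : List A) : Prop :=
  (u = [] ∨ u = [c]) ∧ (v = [] ∨ v = [d]) ∧ (s = true → u = [] ∨ v = [])

lemma endsT_iff {z : List A} {c d : A} {s : Bool} (h : ty z = some (c, d, s)) {u v : List A}
    (hu : u.length ≤ 1) (hv : v.length ≤ 1) :
    EndsT c d s u v ↔ ∃ x, z = u ++ x ++ v := by
  rw [ty_iff] at h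
  obtain ⟨h1, h2, h3⟩ := h
  have hz : z ≠ [] := by rintro rfl; simp at h1
  constructor
  · rintro ⟨hu' | hu', hv' | hv', h4⟩
    · subst hu' hv'; exact ⟨z, by simp⟩
    · subst hu' hv'
      obtain ⟨x, rfl⟩ := List.getLast?_eq_some_iff.1 h2
      exact ⟨x, by simp⟩
    · subst hu' hv'
      obtain ⟨x, rfl⟩ := List.head?_eq_some_iff.1 h1
      exact ⟨x, by simp⟩
    · subst hu' hv'
      obtain ⟨x, rfl⟩ := List.head?_eq_some_iff.1 h1
      have hs : s ≠ true := by intro hs; simpa using h4 hs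
      have hx : x ≠ [] := by rintro rfl; exact hs (h3.2 rfl)
      rw [List.getLast?_cons_of_ne_nil hx] at h2
      obtain ⟨y, rfl⟩ := List.getLast?_eq_some_iff.1 h2
      exact ⟨y, by simp⟩
  · rintro ⟨x, rfl⟩
    refine ⟨?_, ?_, ?_⟩
    · match u, hu with
      | [], _ => simp
      | [a], _ => simp at h1; simp [h1]
    · match v, hv with
      | [], _ => simp
      | [a], _ => simp at h2; simp [h2]
    · intro hs
      have := h3.1 hs
      match u, v with
      | [], _ => simp
      | _, [] => simp
      | _ :: _, _ :: _ => simp at this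

def Comp (R : Set (CircRule A)) (t t' : A × A × Bool) : Prop :=
  ∃ r ∈ R, EndsT t.1 t.2.1 t.2.2 r.u2 r.u1 ∧ EndsT t'.1 t'.2.1 t'.2.2 r.u4 r.u3

inductive Idx (A : Type) where
  | K (a b : A) (s : Bool)
  | W
  | F (s : Bool) (w : List A) (b : A)

inductive Sem (I : Set (List A)) (R : Set (CircRule A)) : Idx A → List A → Prop
  | knil (a b s) : Sem I R (.K a b s) []
  | kcons {a b s c d σ k1 w k2} : Sem I R (.K a c false) k1 → Sem I R .W w →
      ty w = some (c, d, σ) → Sem I R (.K d b false) k2 → Comp R (b, a, s) (c, d, σ) →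
      Sem I R (.K a b s) (k1 ++ w ++ k2)
  | w {w c y s z} : w ∈ I → ty w = some (c, y, s) → Sem I R (.F s w c) z → Sem I R .W z
  | fnil (s b) : Sem I R (.F s [] b) []
  | fcons {s c w b b1 k z} : (w ++ [b]).head? = some b1 → Sem I R (.K c b1 s) k →
      Sem I R (.F s w b) z → Sem I R (.F s (c :: w) b) (c :: (k ++ z))

section sem
variable {I : Set (List A)} {R : Set (CircRule A)}

lemma finv {s w b z} (h : Sem I R (.F s w b) z) :
    (z ++ [b]).head? = (w ++ [b]).head? ∧ w.length ≤ z.length ∧ (w = [] ↔ z = []) := by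
  cases h with
  | fnil => simp
  | fcons h1 h2 h3 =>
    rename_i c w b1 k z
    refine ⟨by simp, ?_, by simp⟩
    suffices w.length ≤ z.length by simp; omega
    clear h1 h2
    generalize hi : Idx.F s w b = i at h3
    induction h3 generalizing w with
    | fnil => cases hi; simp
    | fcons _ _ _ _ ih => cases hi; have := ih rfl; simp; omega
    | _ => cases hi

lemma fapp {s w1 b1 z1 w2 b z2} (h : Sem I R (.F s w1 b1) z1) (h2 : Sem I R (.F s w2 b) z2)
    (hb : (w2 ++ [b]).head? = some b1) : Sem I R (.F s (w1 ++ w2) b) (z1 ++ z2) := by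
  generalize hi : Idx.F s w1 b1 = i at h
  induction h generalizing w1 with
  | fnil => cases hi; simpa using h2
  | fcons g1 g2 g3 _ ih =>
    cases hi
    have := ih rfl
    simp only [List.cons_append, List.append_assoc]
    refine Sem.fcons ?_ g2 this
    rw [List.append_assoc]
    rw [← g1, List.head?_append, hb, List.head?_append]
    rfl
  | _ => cases hi

/-- soundness -/
def SMot (L : Set (List A)) : Idx A → List A → Prop
  | .K a b s, k => ∀ v ∈ L, ty v = some (b, a, s) → v ++ k ∈ L
  | .W, z => z ∈ L
  | .F s w b, z => ∀ y, w ++ y ∈ L → (y ++ w).head? = some b → (s = true ↔ (w ++ y).length = 1) →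
      z ++ y ∈ L

lemma sound {L : Set (List A)} (hI : I ⊆ L) (hc : ∀ x y, x ++ y ∈ L → y ++ x ∈ L)
    (hs : ∀ z w t t', z ∈ L → w ∈ L → ty z = some t → ty w = some t' → Comp R t t' → z ++ w ∈ L)
    {i z} (h : Sem I R i z) : SMot L i z := by
  induction h with
  | knil => intro v hv _; simpa using hv
  | kcons h1 h2 ht h3 hC ih1 ih2 ih3 =>
    rename_i a b s c d σ k1 w k2
    intro v hv htv
    have e1 : v ++ w ∈ L := hs _ _ _ _ hv ih2 htv ht hC
    have e2 := ih3 _ e1 (by rw [ty_append, htv, ht]; rfl)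
    have e3 : (w ++ k2) ++ v ∈ L := hc _ _ (by simpa using e2)
    have e4 := ih1 _ e3 (by
      rw [ty_append, ty_append, htv, ht]
      cases ty k2 <;> rfl)
    have := hc (w ++ k2) (v ++ k1) (by simpa using e4)
    simpa using this
  | w hw ht hF ih =>
    rw [ty_iff] at ht
    change _ ∈ L
    simpa using ih [] (by simpa using hI hw) (by simpa using ht.1) (by simpa using ht.2.2)
  | fnil => intro y hy _ _; simpa using hy
  | fcons hb hK hF ih1 ih2 =>
    rename_i s c w b b1 k z
    intro y hy hh hsg
    obtain ⟨f1, f2, f3⟩ := finv hF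
    have e1 : w ++ (y ++ [c]) ∈ L := by simpa using hc [c] (w ++ y) (by simpa using hy)
    have e2 := ih2 _ e1 (by simpa using hh) (by rw [hsg]; simp only [List.length_append, List.length_cons, List.length_nil]; omega)
    have e3 := ih1 _ e2 (by
      rw [ty_iff]
      refine ⟨?_, by simp, ?_⟩
      · rw [← hb, ← f1]
        cases z with
        | nil => cases y <;> simp_all
        | cons => simp
      · rw [hsg]
        have : w.length = 0 ↔ z.length = 0 := by simpa using f3
        simp only [List.length_append, List.length_cons, List.length_nil]; omega)
    have := hc (z ++ y) (c :: k) (by simpa using e3)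
    simpa using this

/-- insertion -/
def IMot (I : Set (List A)) (R : Set (CircRule A)) : Idx A → List A → Prop
  | .K a b s, k => ∀ k1 k2, k = k1 ++ k2 → ∀ w p q f t, Sem I R .W w → ty w = some t →
      (a :: k1).getLast? = some p → (k2 ++ [b]).head? = some q →
      (f = true ↔ s = true ∧ k = []) → Comp R (q, p, f) t → Sem I R (.K a b s) (k1 ++ w ++ k2)
  | .W, z => ∀ z1 z2, z = z1 ++ z2 → ∀ w p q f t, Sem I R .W w → ty w = some t →
      z1.getLast? = some p → (z2 ++ z).head? = some q →
      (f = true ↔ z.length = 1) → Comp R (q, p, f) t → Sem I R .W (z1 ++ w ++ z2)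
  | .F s w0 b, z => (s = true → w0.length = 1) → ∀ z1 z2, z = z1 ++ z2 →
      ∀ w p q f t, Sem I R .W w → ty w = some t →
      z1.getLast? = some p → (z2 ++ [b]).head? = some q →
      (f = true ↔ s = true ∧ z.length = 1) → Comp R (q, p, f) t →
      Sem I R (.F s w0 b) (z1 ++ w ++ z2)

lemma ins {i z} (h : Sem I R i z) : IMot I R i z := by
  induction h with
  | knil a b s =>
    intro k1 k2 hk w p q f t hw ht hp hq hf hC
    obtain ⟨rfl, rfl⟩ := List.append_eq_nil_iff.1 hk.symm
    simp at hp hq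
    subst hp hq
    have : f = s := by cases f <;> cases s <;> simp_all
    subst this
    exact Sem.kcons (Sem.knil _ _ _) hw ht (Sem.knil _ _ _) hC
  | kcons h1 h2 ht h3 hC ih1 ih2 ih3 =>
    rename_i a b s c d σ k1 w k2
    intro l1 l2 hk w' p q f t hw ht' hp hq hf hC'
    have hwne := ty_ne ht
    have htt := ty_iff.1 ht
    have hf' : f = false := by
      cases f with
      | false => rfl
      | true => simp [hwne] at hf
    subst hf'
    clear hf
    rw [List.append_assoc] at hk
    have case3 : ∀ u, k2 = u ++ l2 → l1 = k1 ++ w ++ u →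
        Sem I R (.K a b s) (l1 ++ w' ++ l2) := by
      rintro u hu rfl
      have := ih3 u l2 hu w' p q false t hw ht' (by
        rw [← hp]
        cases u with
        | nil => simp [List.getLast?_cons, List.getLast?_append, htt.2.1]
        | cons => simp [List.getLast?_cons, List.getLast?_append]) hq (by simp) hC'
      simpa using Sem.kcons h1 h2 ht this hC
    rcases List.append_eq_append_iff.1 hk with ⟨u, rfl, hu⟩ | ⟨u, rfl, rfl⟩
    · rcases List.append_eq_append_iff.1 hu with ⟨v, rfl, hv⟩ | ⟨v, rfl, rfl⟩
      · exact case3 v hv (by simp)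
      · by_cases hv : v = []
        · subst hv
          exact case3 [] (by simp) (by simp)
        by_cases hu : u = []
        · subst hu
          have := ih1 k1 [] (by simp) w' p q false t hw ht' (by simpa using hp) (by
            rw [← hq]
            simp [List.head?_append] at htt ⊢
            simp [htt]) (by simp) hC'
          simpa using Sem.kcons this h2 ht h3 hC
        · have hl : (u ++ v).length ≠ 1 := by
            have := List.length_pos_of_ne_nil hu
            have := List.length_pos_of_ne_nil hv
            simp; omega
          have hσ : σ = false := by
            cases σ with
            | false => rfl
            | true => exact absurd (htt.2.2.1 rfl) hl
          subst hσ
          have e := ih2 u v rfl w' p q false t hw ht' (by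
            rw [← hp]
            obtain ⟨x, y, rfl⟩ := List.eq_nil_or_concat u |>.resolve_left hu
            simp [List.getLast?_cons, List.getLast?_append]) (by
            rw [← hq]
            cases v with
            | nil => simp at hv
            | cons => simp) (by simpa using hl) hC'
          have ht2 : ty (u ++ w' ++ v) = some (c, d, false) := by
            rw [ty_append] at ht
            rw [ty_append, ty_append, ht']
            obtain ⟨_, _, _, h1⟩ := ty_of_ne hu
            obtain ⟨_, _, _, h2⟩ := ty_of_ne hv
            rw [h1, h2] at ht ⊢
            simpa [mul] using ht
          simpa using Sem.kcons h1 e ht2 h3 hC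
    · have := ih1 l1 u rfl w' p q false t hw ht' hp (by
            rw [← hq]
            cases u with
            | nil => simp [List.head?_append, htt.1]
            | cons => simp) (by simp) hC'
      simpa using Sem.kcons this h2 ht h3 hC
  | w hw ht hF ih =>
    rename_i w0 c y s z
    intro z1 z2 hz w p q f t hw' ht' hp hq hf hC
    obtain ⟨f1, f2, f3⟩ := finv hF
    have hne := ty_ne ht
    have htt := ty_iff.1 ht
    have hpos := List.length_pos_of_ne_nil hne
    refine Sem.w hw ht (ih htt.2.2.1 z1 z2 hz w p q f t hw' ht' hp ?_ ?_ hC)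
    · rw [← hq]
      have : z.head? = some c := by
        cases z with
        | nil => exact absurd (f3.2 rfl) hne
        | cons =>
          cases w0 with
          | nil => simp at hne
          | cons => simp at f1 htt; simp [f1, htt]
      simp [List.head?_append, this]
    · rw [hf, htt.2.2]
      constructor
      · intro h; exact ⟨by omega, h⟩
      · exact fun h => h.2
  | fnil =>
    intro hs z1 z2 hz w p q f t hw' ht' hp hq hf hC
    obtain ⟨rfl, rfl⟩ := List.append_eq_nil_iff.1 hz.symm
    simp at hp
  | fcons hb hK hF ih1 ih2 =>
    rename_i s c w b b1 k z
    intro hs z1 z2 hz w' p q f t hw' ht' hp hq hf hC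
    obtain ⟨f1, f2, f3⟩ := finv hF
    cases z1 with
    | nil => simp at hp
    | cons c' z1 =>
    simp only [List.cons_append, List.cons.injEq] at hz
    obtain ⟨rfl, hz⟩ := hz
    have casek : ∀ u, k = z1 ++ u → z2 = u ++ z →
        Sem I R (.F s (c :: w) b) (c :: z1 ++ w' ++ z2) := by
      rintro u hk rfl
      have := ih1 z1 u hk w' p q f t hw' ht' hp (by
        rw [← hq]
        cases u with
        | nil => simp only [List.nil_append, f1, hb]; simp
        | cons => simp) (by
        rw [hf]
        constructor
        · rintro ⟨h1, h2⟩
          refine ⟨h1, ?_⟩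
          simp at h2; exact h2.1
        · rintro ⟨h1, h2⟩
          refine ⟨h1, ?_⟩
          have := hs h1
          have hw0 : w = [] := by simpa using this
          simp [h2, f3.1 hw0]) hC
      simpa using Sem.fcons hb this hF
    rcases List.append_eq_append_iff.1 hz with ⟨u, rfl, hu⟩ | ⟨u, hk, hu⟩
    · by_cases hun : u = []
      · subst hun
        exact casek [] (by simp) (by simpa using hu.symm)
      have hzne : z ≠ [] := by rw [hu]; simp [hun]
      have hwne : w ≠ [] := fun h => hzne (f3.1 h)
      have hs' : s = false := by
        cases s with
        | false => rfl
        | true => exact absurd (hs rfl) (by simpa using hwne)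
      have := ih2 (by simp [hs']) u z2 hu w' p q f t hw' ht' (by
        rw [← hp]
        obtain ⟨x, y, rfl⟩ := List.eq_nil_or_concat u |>.resolve_left hun
        simp [List.getLast?_cons, List.getLast?_append]) hq (by rw [hf]; simp [hs']) hC
      simpa using Sem.fcons (k := k) (by
        exact hb) hK this
    · exact casek u hk hu

lemma semw_ne {z} (h : Sem I R .W z) : z ≠ [] := by
  cases h with
  | w h1 h2 h3 =>
    intro h
    exact ty_ne h2 ((finv h3).2.2.2 h)

lemma idfill {s : Bool} (w : List A) (b : A) : Sem I R (.F s w b) w := by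
  induction w with
  | nil => exact Sem.fnil _ _
  | cons c w ih =>
    obtain ⟨b1, hb⟩ : ∃ b1, (w ++ [b]).head? = some b1 := by cases w <;> simp
    simpa using Sem.fcons hb (Sem.knil _ _ _) ih

lemma comp_symm (hsym : ∀ r ∈ R, (⟨r.u3, r.u4, r.u1, r.u2⟩ : CircRule A) ∈ R) {t t'}
    (h : Comp R t t') : Comp R t' t := by
  obtain ⟨r, hr, h1, h2⟩ := h
  exact ⟨_, hsym r hr, h2, h1⟩

/-- insertion in a rotated word -/
lemma insrot {z1 z2 w t t'} (hz : Sem I R .W (z2 ++ z1)) (hz1 : z2 ≠ [])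
    (hw : Sem I R .W w) (ht : ty (z1 ++ z2) = some t) (ht' : ty w = some t') (hC : Comp R t t') :
    Sem I R .W (z2 ++ w ++ z1) := by
  obtain ⟨q, p, f⟩ := t
  rw [ty_iff] at ht
  refine ins hz z2 z1 rfl w p q f t' hw ht' ?_ ?_ ?_ hC
  · rw [← ht.2.1]
    obtain ⟨x, y, rfl⟩ := List.eq_nil_or_concat z2 |>.resolve_left hz1
    simp [List.getLast?_append]
  · rw [← ht.1]
    cases z1 <;> simp
  · rw [ht.2.2]; simp; omega

def G (I : Set (List A)) (R : Set (CircRule A)) : Set (List A) :=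
  {z | (z = [] ∧ [] ∈ I) ∨ Sem I R .W z}

lemma rot {P : Set (List A)} : ∀ z, (∀ x y, z = x ++ y → y ++ x ∈ P) → ∀ z', WordConj z' z →
    ∀ x y, z' = x ++ y → y ++ x ∈ P := by
  rintro z hz z' ⟨a, b, rfl, rfl⟩ x y h
  rcases List.append_eq_append_iff.1 h with ⟨u, rfl, rfl⟩ | ⟨u, rfl, rfl⟩
  · simpa using hz u (y ++ a) (by simp)
  · simpa using hz (b ++ x) u (by simp)

lemma G_eq (hconj : ∀ w ∈ I, ∀ w', WordConj w w' → w' ∈ I)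
    (hsym : ∀ r ∈ R, (⟨r.u3, r.u4, r.u1, r.u2⟩ : CircRule A) ∈ R)
    (halph : ∀ r ∈ R,
      r.u1.length ≤ 1 ∧ r.u2.length ≤ 1 ∧ r.u3.length ≤ 1 ∧ r.u4.length ≤ 1) :
    CircLang I R = G I R := by
  have hIG : ∀ w ∈ I, w ∈ G I R := by
    intro w hw
    by_cases h : w = []
    · left; subst h; exact ⟨rfl, hw⟩
    · right
      obtain ⟨c, d, s, ht⟩ := ty_of_ne h
      exact Sem.w hw ht (idfill _ _)
  have hGW : ∀ w ∈ G I R, w ≠ [] → Sem I R .W w := by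
    rintro w (h | h) hne
    · exact absurd h.1 hne
    · exact h
  apply Set.Subset.antisymm
  · have key : {z | ∀ x y, z = x ++ y → y ++ x ∈ G I R} ∈ {L : Set (List A) |
        (∀ w ∈ I, ∀ w', WordConj w w' → w' ∈ L) ∧ ∀ w, CircStep R L w → w ∈ L} := by
      constructor
      · intro w hw w' hc x y h
        exact hIG _ (hconj _ (hconj _ hw _ hc) _ ⟨x, y, h, rfl⟩)
      · rintro w ⟨r, hr, x, y, hx, hy, hc⟩
        refine rot _ ?_ _ hc
        clear hc w
        have hx' : r.u2 ++ x ++ r.u1 ∈ {z | ∀ x y, z = x ++ y → y ++ x ∈ G I R} := hx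
        obtain ⟨a1, a2, a3, a4⟩ := halph r hr
        generalize hZ : r.u2 ++ x ++ r.u1 = Z at *
        have : Z ++ r.u4 ++ y ++ r.u3 = Z ++ (r.u4 ++ y ++ r.u3) := by simp
        rw [this]
        generalize hW : r.u4 ++ y ++ r.u3 = W at *
        by_cases hZn : Z = []
        · rw [hZn]; simpa using hy
        by_cases hWn : W = []
        · rw [hWn]; simpa using hx
        obtain ⟨c, d, s, ht⟩ := ty_of_ne hZn
        obtain ⟨c', d', s', ht'⟩ := ty_of_ne hWn
        have hC : Comp R (c, d, s) (c', d', s') :=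
          ⟨r, hr, (endsT_iff ht a2 a1).2 ⟨x, hZ.symm⟩, (endsT_iff ht' a4 a3).2 ⟨y, hW.symm⟩⟩
        have hC' := comp_symm hsym hC
        have hZS : Sem I R .W Z := hGW _ (by simpa using hx [] Z (by simp)) hZn
        have hWS : Sem I R .W W := hGW _ (by simpa using hy [] W (by simp)) hWn
        intro l1 l2 hl
        right
        have caseW : ∀ u, W = u ++ l2 → l1 = Z ++ u → l2 ≠ [] → Sem I R .W (l2 ++ l1) := by
          rintro u rfl rfl hne
          have := insrot (z1 := u) (z2 := l2) (hGW _ (hy u l2 rfl) (by simp [hne])) hne hZS ht' ht hC'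
          simpa using this
        have caseZ : ∀ u, Z = l1 ++ u → l2 = u ++ W → u ≠ [] → Sem I R .W (l2 ++ l1) := by
          rintro u rfl rfl hne
          have := insrot (z1 := l1) (z2 := u) (hGW _ (hx l1 u rfl) (by simp [hne])) hne hWS ht ht' hC
          simpa using this
        rcases List.append_eq_append_iff.1 hl with ⟨u, h1, h2⟩ | ⟨u, h1, h2⟩
        · by_cases h : l2 = []
          · subst h
            have := insrot (z1 := []) (z2 := Z) (by simpa using hZS) hZn hWS (by simpa using ht) ht' hC
            simp at hl
            simpa [← hl] using this
          · exact caseW u h2 h1 h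
        · by_cases h : u = []
          · subst h
            exact caseW [] (by simpa using h2.symm) (by simpa using h1.symm) (by simpa [h2] using hWn)
          · exact caseZ u h1 h2 h
    intro z hz
    have := Set.mem_sInter.1 hz _ key [] z rfl
    simpa using this
  · intro z hz
    rw [CircLang, Set.mem_sInter]
    rintro L ⟨hL1, hL2⟩
    let L' : Set (List A) := {z | ∀ x y, z = x ++ y → y ++ x ∈ L}
    have hLL : ∀ z ∈ L', z ∈ L := fun z hz => by simpa using hz [] z rfl
    have hIL : I ⊆ L' := by
      rintro w hw x y rfl
      exact hL1 _ hw _ ⟨x, y, rfl, rfl⟩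
    rcases hz with ⟨rfl, hz⟩ | hz
    · exact hLL _ (hIL hz)
    · refine hLL _ (sound (L := L') hIL ?_ ?_ hz)
      · intro x y hxy
        exact rot (P := L) _ hxy _ ⟨y, x, rfl, rfl⟩
      · rintro z w ⟨c, d, s⟩ ⟨c', d', s'⟩ hz hw ht ht' ⟨r, hr, h1, h2⟩ x y hxy
        obtain ⟨a1, a2, a3, a4⟩ := halph r hr
        obtain ⟨u, rfl⟩ := (endsT_iff ht a2 a1).1 h1
        obtain ⟨v, rfl⟩ := (endsT_iff ht' a4 a3).1 h2
        refine hL2 _ ⟨r, hr, u, v, hLL _ hz, hLL _ hw, y, x, rfl, ?_⟩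
        rw [← hxy]; simp

end sem

section gram

variable {N : Type}

inductive Der (P : Set (ContextFreeRule A N)) : List (Symbol A N) → List A → Prop
  | nil : Der P [] []
  | term {t s w} : Der P s w → Der P (.terminal t :: s) (t :: w)
  | nt {r s u v} : r ∈ P → Der P r.output u → Der P s v → Der P (.nonterminal r.input :: s) (u ++ v)

lemma Der.app {P : Set (ContextFreeRule A N)} {s t u v} (h : Der P s u) (h2 : Der P t v) :
    Der P (s ++ t) (u ++ v) := by
  induction h with
  | nil => simpa using h2
  | term _ ih => exact Der.term ih
  | nt hr h1 _ _ ih => simpa using Der.nt hr h1 ih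

lemma Der.split {P : Set (ContextFreeRule A N)} {s t w} (h : Der P (s ++ t) w) :
    ∃ u v, w = u ++ v ∧ Der P s u ∧ Der P t v := by
  generalize hi : s ++ t = l at h
  induction h generalizing s with
  | nil =>
    obtain ⟨rfl, rfl⟩ := List.append_eq_nil_iff.1 hi
    exact ⟨[], [], rfl, .nil, .nil⟩
  | term h ih =>
    cases s with
    | nil => simp at hi; subst hi; exact ⟨[], _, rfl, .nil, .term h⟩
    | cons a s =>
      simp at hi
      obtain ⟨rfl, hi⟩ := hi
      obtain ⟨u, v, rfl, h1, h2⟩ := ih hi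
      exact ⟨_, v, rfl, .term h1, h2⟩
  | nt hr h1 h2 _ ih =>
    cases s with
    | nil => simp at hi; subst hi; exact ⟨[], _, rfl, .nil, .nt hr h1 h2⟩
    | cons a s =>
      simp at hi
      obtain ⟨rfl, hi⟩ := hi
      obtain ⟨u, v, rfl, h3, h4⟩ := ih hi
      exact ⟨_, v, (List.append_assoc _ _ _).symm, .nt hr h1 h3, h4⟩

lemma Der.one {P : Set (ContextFreeRule A N)} {r : ContextFreeRule A N} {w} (hr : r ∈ P)
    (h : Der P r.output w) : Der P [.nonterminal r.input] w := by
  simpa using Der.nt hr h Der.nil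

lemma der_terminal {P : Set (ContextFreeRule A N)} (w : List A) :
    Der P (w.map Symbol.terminal) w := by
  induction w with
  | nil => exact .nil
  | cons a w ih => exact .term ih

lemma derives_iff (g : ContextFreeGrammar A) (s : List (Symbol A g.NT)) (w : List A) :
    g.Derives s (w.map Symbol.terminal) ↔ Der (g.rules : Set (ContextFreeRule A g.NT)) s w := by
  constructor
  · intro h
    induction h using Relation.ReflTransGen.head_induction_on with
    | refl => exact der_terminal w
    | head hp _ ih =>
      obtain ⟨r, hr, hrw⟩ := hp
      obtain ⟨p, q, rfl, rfl⟩ := hrw.exists_parts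
      obtain ⟨_, w3, rfl, h12, h3⟩ := ih.split
      obtain ⟨w1, w2, rfl, h1, h2⟩ := h12.split
      exact (h1.app (Der.one hr h2)).app h3
  · intro h
    induction h with
    | nil => exact Relation.ReflTransGen.refl
    | term _ ih => exact ih.append_left [_]
    | nt hr h1 h2 ih1 ih2 =>
      rename_i r s u v
      have e1 : g.Produces (.nonterminal r.input :: s) (r.output ++ s) := ⟨r, hr, .head s⟩
      have e2 := ih1.append_right s
      have e3 := ih2.append_left (u.map Symbol.terminal)
      rw [List.map_append]
      exact (e1.trans_derives e2).trans e3

def SatL (sat : N → List A → Prop) : List (Symbol A N) → List A → Prop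
  | [], z => z = []
  | .terminal a :: s, z => ∃ v, z = a :: v ∧ SatL sat s v
  | .nonterminal X :: s, z => ∃ u v, z = u ++ v ∧ sat X u ∧ SatL sat s v

lemma Der.sat {P : Set (ContextFreeRule A N)} {sat : N → List A → Prop}
    (hs : ∀ r ∈ P, ∀ z, SatL sat r.output z → sat r.input z) {s z} (h : Der P s z) :
    SatL sat s z := by
  induction h with
  | nil => rfl
  | term _ ih => exact ⟨_, rfl, ih⟩
  | nt hr _ _ ih1 ih2 => exact ⟨_, _, rfl, hs _ hr _ ih1, ih2⟩

abbrev St (A : Type) := Bool × Ty A × Ty A × A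

inductive N' (A N : Type) where
  | P (sym : Symbol A N) (p q : St A)
  | K (t : Ty A) (a b : A) (s : Bool)
  | W (t : Ty A)
  | start

inductive Annot : List (Symbol A N) → St A → List (Symbol A (N' A N)) → St A → Prop
  | nil (p) : Annot [] p [] p
  | cons {x s p q r out} : Annot s q out r → Annot (x :: s) p (.nonterminal (.P x p q) :: out) r

variable (I : Set (List A)) (R : Set (CircRule A)) (g : ContextFreeGrammar A)

inductive GR : ContextFreeRule A (N' A g.NT) → Prop
  | eps : [] ∈ I → GR ⟨.start, []⟩
  | start (t) : GR ⟨.start, [.nonterminal (.W t)]⟩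
  | knil (a b s) : GR ⟨.K none a b s, []⟩
  | kcons (a b s c d σ t1 t3) : Comp R (b, a, s) (c, d, σ) →
      GR ⟨.K (mul t1 (mul (some (c, d, σ)) t3)) a b s,
        [.nonterminal (.K t1 a c false), .nonterminal (.W (some (c, d, σ))),
          .nonterminal (.K t3 d b false)]⟩
  | w (s c y t) : GR ⟨.W t, [.nonterminal (.P (.nonterminal g.initial) (s, none, none, c)
      (s, some (c, y, s), t, c))]⟩
  | letter (s rt et c b tk) : GR ⟨.P (.terminal c) (s, rt, et, c)
      (s, mul rt (ty [c]), mul et (mul (ty [c]) tk), b),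
      [.terminal c, .nonterminal (.K tk c b s)]⟩
  | prod (r p q out) : r ∈ g.rules → Annot r.output p out q → GR ⟨.P (.nonterminal r.input) p q, out⟩

def GS : Set (ContextFreeRule A (N' A g.NT)) := {r | GR I R g r}

lemma annot_fin [Finite A] (s : List (Symbol A N)) : ∀ (p q : St A),
    {out | Annot s p out q}.Finite := by
  induction s with
  | nil =>
    intro p q
    refine (Set.finite_singleton []).subset ?_
    intro out h
    cases h; rfl
  | cons x s ih =>
    intro p q
    refine (Set.finite_iUnion fun m : St A =>
      (ih m q).image fun out => Symbol.nonterminal (.P x p m) :: out).subset ?_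
    intro out h
    cases h with
    | cons h => exact Set.mem_iUnion.2 ⟨_, _, h, rfl⟩

lemma GS_fin [Finite A] : (GS I R g).Finite := by
  have f1 : ({⟨.start, []⟩} : Set (ContextFreeRule A (N' A g.NT))).Finite := Set.finite_singleton _
  have f2 := Set.finite_range (fun t : Ty A =>
    (⟨.start, [.nonterminal (.W t)]⟩ : ContextFreeRule A (N' A g.NT)))
  have f3 := Set.finite_range (fun t : A × A × Bool =>
    (⟨.K none t.1 t.2.1 t.2.2, []⟩ : ContextFreeRule A (N' A g.NT)))
  have f4 := Set.finite_range (fun t : (A × A × Bool) × (A × A × Bool) × Ty A × Ty A =>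
    (⟨.K (mul t.2.2.1 (mul (some t.2.1) t.2.2.2)) t.1.1 t.1.2.1 t.1.2.2,
      [.nonterminal (.K t.2.2.1 t.1.1 t.2.1.1 false), .nonterminal (.W (some t.2.1)),
          .nonterminal (.K t.2.2.2 t.2.1.2.1 t.1.2.1 false)]⟩ : ContextFreeRule A (N' A g.NT)))
  have f5 := Set.finite_range (fun t : Bool × A × A × Ty A =>
    (⟨.W t.2.2.2, [.nonterminal (.P (.nonterminal g.initial) (t.1, none, none, t.2.1)
      (t.1, some (t.2.1, t.2.2.1, t.1), t.2.2.2, t.2.1))]⟩ : ContextFreeRule A (N' A g.NT)))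
  have f6 := Set.finite_range (fun t : Bool × Ty A × Ty A × A × A × Ty A =>
    (⟨.P (.terminal t.2.2.2.1) (t.1, t.2.1, t.2.2.1, t.2.2.2.1)
      (t.1, mul t.2.1 (ty [t.2.2.2.1]), mul t.2.2.1 (mul (ty [t.2.2.2.1]) t.2.2.2.2.2), t.2.2.2.2.1),
      [.terminal t.2.2.2.1, .nonterminal (.K t.2.2.2.2.2 t.2.2.2.1 t.2.2.2.2.1 t.1)]⟩ :
      ContextFreeRule A (N' A g.NT)))
  have f7 := g.rules.finite_toSet.biUnion (fun r _ => Set.finite_iUnion fun t : St A × St A =>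
      (annot_fin r.output t.1 t.2).image fun out =>
        (⟨.P (.nonterminal r.input) t.1 t.2, out⟩ : ContextFreeRule A (N' A g.NT)))
  refine ((((((f1.union f2).union f3).union f4).union f5).union f6).union f7).subset ?_
  intro r hr
  cases hr with
  | eps => left; left; left; left; left; left; rfl
  | start t => left; left; left; left; left; right; exact ⟨t, rfl⟩
  | knil a b s => left; left; left; left; right; exact ⟨(a, b, s), rfl⟩
  | kcons a b s c d σ t1 t3 => left; left; left; right; exact ⟨((a, b, s), (c, d, σ), t1, t3), rfl⟩
  | w s c y t => left; left; right; exact ⟨(s, c, y, t), rfl⟩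
  | letter s rt et c b tk => left; right; exact ⟨(s, rt, et, c, b, tk), rfl⟩
  | prod r p q out h1 h2 =>
    right
    exact Set.mem_biUnion h1 (Set.mem_iUnion.2 ⟨(p, q), out, h2, rfl⟩)

def FPath (p : St A) (w : List A) (q : St A) (z : List A) : Prop :=
  q.1 = p.1 ∧ Sem I R (.F p.1 w q.2.2.2) z ∧ q.2.1 = mul p.2.1 (ty w) ∧
    q.2.2.1 = mul p.2.2.1 (ty z) ∧ (w ++ [q.2.2.2]).head? = some p.2.2.2

def sat : N' A g.NT → List A → Prop
  | .P x p q, z => ∃ w, Der (g.rules : Set (ContextFreeRule A g.NT)) [x] w ∧ FPath I R p w q z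
  | .K t a b s, z => ty z = t ∧ Sem I R (.K a b s) z
  | .W t, z => ty z = t ∧ Sem I R .W z
  | .start, z => z ∈ G I R

lemma fpath_app {p w1 q z1 w2 r z2} (h1 : FPath I R p w1 q z1) (h2 : FPath I R q w2 r z2) :
    FPath I R p (w1 ++ w2) r (z1 ++ z2) := by
  obtain ⟨a1, a2, a3, a4, a5⟩ := h1
  obtain ⟨b1, b2, b3, b4, b5⟩ := h2
  refine ⟨b1.trans a1, ?_, ?_, ?_, ?_⟩
  · rw [a1] at b2
    exact fapp a2 b2 b5
  · rw [b3, a3, ty_append, mul_assoc']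
  · rw [b4, a4, ty_append, mul_assoc']
  · rw [← a5]
    cases w1 with
    | nil => simpa using b5
    | cons => simp

lemma annot_sat {s p out q z} (h : Annot s p out q) (hz : SatL (sat I R g) out z) :
    ∃ w, Der (g.rules : Set (ContextFreeRule A g.NT)) s w ∧ FPath I R p w q z := by
  induction h generalizing z with
  | nil p =>
    cases hz
    exact ⟨[], .nil, rfl, .fnil _ _, by simp, by simp, by simp⟩
  | cons _ ih =>
    obtain ⟨u, v, rfl, ⟨w1, h1, h2⟩, hv⟩ := hz
    obtain ⟨w2, h3, h4⟩ := ih hv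
    exact ⟨w1 ++ w2, h1.app h3, fpath_app I R h2 h4⟩

lemma gsat (hg : (g.language : Set (List A)) = I) :
    ∀ r ∈ GS I R g, ∀ z, SatL (sat I R g) r.output z → sat I R g r.input z := by
  intro r hr z hz
  cases hr with
  | eps h => cases hz; exact Or.inl ⟨rfl, h⟩
  | start t =>
    obtain ⟨u, v, rfl, ⟨_, h⟩, rfl⟩ := hz
    right; simpa using h
  | knil a b s => cases hz; exact ⟨rfl, .knil _ _ _⟩
  | kcons a b s c d σ t1 t3 hC =>
    obtain ⟨k1, _, rfl, ⟨h1, h1'⟩, w, _, rfl, ⟨h2, h2'⟩, k2, _, rfl, ⟨h3, h3'⟩, rfl⟩ := hz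
    refine ⟨?_, ?_⟩
    · simp [ty_append, h1, h2, h3]
    · simpa using Sem.kcons h1' h2' h2 h3' hC
  | w s c y t =>
    obtain ⟨u, v, rfl, ⟨w, hw, a1, a2, a3, a4, a5⟩, rfl⟩ := hz
    have hwI : w ∈ I := by
      rw [← hg]
      exact (derives_iff g _ w).2 hw
    simp at a3 a4
    refine ⟨by simpa using a4.symm, ?_⟩
    simpa using Sem.w hwI a3.symm a2
  | letter s rt et c b tk =>
    obtain ⟨_, rfl, k, _, rfl, ⟨h1, h2⟩, rfl⟩ := hz
    refine ⟨[c], .term .nil, rfl, ?_, rfl, ?_, by simp⟩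
    · exact Sem.fcons (w := []) (by simp) h2 (.fnil _ _)
    · have : c :: (k ++ []) = [c] ++ k := by simp
      rw [this, ty_append, h1]
  | prod r p q out h1 h2 =>
    obtain ⟨w, hw, hp⟩ := annot_sat I R g h2 hz
    exact ⟨w, Der.one h1 hw, hp⟩

inductive Path : St A → List A → St A → List A → Prop
  | nil (p) : Path p [] p []
  | cons {p c q u w r v} : Der (GS I R g) [.nonterminal (.P (.terminal c) p q)] u → Path q w r v →
      Path p (c :: w) r (u ++ v)

lemma Path.split {p w1 w2 q z} (h : Path I R g p (w1 ++ w2) q z) :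
    ∃ m z1 z2, z = z1 ++ z2 ∧ Path I R g p w1 m z1 ∧ Path I R g m w2 q z2 := by
  induction w1 generalizing p z with
  | nil => exact ⟨p, [], z, rfl, .nil _, h⟩
  | cons c w1 ih =>
    cases h with
    | cons h1 h2 =>
      obtain ⟨m, z1, z2, rfl, h3, h4⟩ := ih h2
      exact ⟨m, _, z2, (List.append_assoc _ _ _).symm, .cons h1 h3, h4⟩

lemma path_annot {s w p q z} (h : Der (g.rules : Set (ContextFreeRule A g.NT)) s w)
    (hp : Path I R g p w q z) : ∃ out, Annot s p out q ∧ Der (GS I R g) out z := by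
  induction h generalizing p q z with
  | nil => cases hp; exact ⟨[], .nil _, .nil⟩
  | term _ ih =>
    cases hp with
    | cons h1 h2 =>
      obtain ⟨out, h3, h4⟩ := ih h2
      exact ⟨_, .cons h3, h1.app h4⟩
  | nt hr _ _ ih1 ih2 =>
    obtain ⟨m, z1, z2, rfl, h3, h4⟩ := Path.split I R g hp
    obtain ⟨o1, a1, d1⟩ := ih1 h3
    obtain ⟨o2, a2, d2⟩ := ih2 h4
    exact ⟨_, .cons a2, (Der.one (GR.prod _ _ _ _ hr a1) d1).app d2⟩

def CMot : Idx A → List A → Prop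
  | .K a b s, z => Der (GS I R g) [.nonterminal (.K (ty z) a b s)] z
  | .W, z => Der (GS I R g) [.nonterminal (.W (ty z))] z
  | .F s w b, z => ∀ rt et c, (w ++ [b]).head? = some c →
      Path I R g (s, rt, et, c) w (s, mul rt (ty w), mul et (ty z), b) z

lemma complete (hg : (g.language : Set (List A)) = I) {i z} (h : Sem I R i z) :
    CMot I R g i z := by
  induction h with
  | knil a b s => exact Der.one (GR.knil a b s) .nil
  | kcons h1 h2 ht h3 hC ih1 ih2 ih3 =>
    rename_i a b s c d σ k1 w k2
    change Der _ _ _ at ih1 ih2 ih3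
    rw [ht] at ih2
    have := Der.one (GR.kcons (I := I) (g := g) a b s c d σ (ty k1) (ty k2) hC) ((ih1.app ih2).app ih3)
    change Der _ _ _
    rw [ty_append, ty_append, ht, mul_assoc']
    exact this
  | w hw ht hF ih =>
    rename_i w c y s z
    have hw' : Der (g.rules : Set (ContextFreeRule A g.NT)) [.nonterminal g.initial] w := by
      rw [← hg] at hw
      exact (derives_iff g _ w).1 hw
    have hp := ih none none c (by simp [List.head?_append, (ty_iff.1 ht).1])
    simp only [none_mul, ht] at hp
    obtain ⟨out, ha, hd⟩ := path_annot I R g hw' hp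
    refine Der.one (GR.w s c y (ty z)) ?_
    cases ha with
    | cons ha => cases ha; exact hd
  | fnil s b =>
    intro rt et c hc
    simp at hc
    subst hc
    simpa using Path.nil _
  | fcons hb hK hF ih1 ih2 =>
    rename_i s c w b b1 k z
    intro rt et c' hc
    simp at hc
    subst hc
    change Der _ _ _ at ih1
    have e1 : Der (GS I R g) _ (c :: k) := Der.one (GR.letter (I := I) (R := R) (g := g) s rt et c b1 (ty k)) (Der.term ih1)
    have e2 := ih2 (mul rt (ty [c])) (mul et (mul (ty [c]) (ty k))) b1 hb
    have e3 := Path.cons e1 e2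
    have t1 : ty (c :: w) = mul (ty [c]) (ty w) := ty_append [c] w
    have t2 : ty (c :: (k ++ z)) = mul (mul (ty [c]) (ty k)) (ty z) := by
      rw [← ty_append, ← ty_append]; simp
    rw [t1, t2, ← mul_assoc', ← mul_assoc']
    exact e3

lemma G_cf [Finite A] (hg : (g.language : Set (List A)) = I) :
    Language.IsContextFree (G I R : Language A) := by
  refine ⟨⟨N' A g.NT, .start, (GS_fin I R g).toFinset⟩, ?_⟩
  ext z
  rw [ContextFreeGrammar.mem_language_iff, derives_iff]
  simp only [Set.Finite.coe_toFinset]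
  constructor
  · intro h
    obtain ⟨u, v, rfl, h', rfl⟩ := h.sat (gsat I R g hg)
    rw [List.append_nil]
    exact h'
  · rintro (⟨rfl, h⟩ | h)
    · exact Der.one (GR.eps h) .nil
    · exact Der.one (GR.start (ty z)) (complete I R g hg h)

end gram


end Spl

/-- The circular language generated by an alphabetic context-free Păun circular
splicing system is context-free: if the full linearization `I` of the initial circular
language is context-free (and conjugacy-closed), `R` is a finite symmetric set of rules
all of whose components are letters or the empty word, then the full linearization of
the generated circular language is context-free. -/
theorem stmt4 {A : Type} [Fintype A] (I : Set (List A)) (R : Set (CircRule A))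
    (hR : R.Finite)
    (hconj : ∀ w ∈ I, ∀ w', WordConj w w' → w' ∈ I)
    (hsym : ∀ r ∈ R, (⟨r.u3, r.u4, r.u1, r.u2⟩ : CircRule A) ∈ R)
    (hI : Language.IsContextFree (I : Language A))
    (halph : ∀ r ∈ R,
      r.u1.length ≤ 1 ∧ r.u2.length ≤ 1 ∧ r.u3.length ≤ 1 ∧ r.u4.length ≤ 1) :
    Language.IsContextFree (CircLang I R : Language A) := by
  obtain ⟨g, hg⟩ := hI
  rw [Spl.G_eq hconj hsym halph]
  exact Spl.G_cf I R g hg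
end

section
/- Let S = (I,R) be a marked system and let {(I_h, R^{I_h}) : 1 ≤ h ≤ g} be its canonical decomposition, given by the decomposition of the associated graph G = (I,R) into its connected components G_h = (I_h, R^{I_h}). Then the circular language L(I,R) generated by S is the disjoint union of the circular languages L(I_h, R^{I_h}) generated by the maximal transitive subsystems of its canonical decomposition: L(I,R) = ⋃_{h=1}^{g} L(I_h, R^{I_h}), and these languages are pairwise disjoint. -/
/-- One splicing step of a marked system (at the level of full linearizations):
the rule `(a,b)` splices circular words `~(x a)` and `~(y b)` into `~(x a y b)`. -/
def MarkedStep {A : Type*} (R : Set (A × A)) (L : Set (List A)) (w : List A) : Prop :=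
  ∃ (a b : A) (x y : List A), (a, b) ∈ R ∧ x ++ [a] ∈ L ∧ y ++ [b] ∈ L ∧
    WordConj w (x ++ [a] ++ y ++ [b])

/-- The full linearization of the circular language `L(I,R)` generated by the marked
system `(I,R)`: the smallest set of words containing the one-letter words `[a]`, `a ∈ I`,
and closed under the splicing steps (conjugates included). -/
def MarkedLang {A : Type*} (I : Set A) (R : Set (A × A)) : Set (List A) :=
  ⋂₀ {L : Set (List A) | (∀ a ∈ I, [a] ∈ L) ∧ ∀ w, MarkedStep R L w → w ∈ L}

/-- `RChain R J a b k` : there is a sequence `b_1, …, b_k` of vertices of `J` with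
`b_1 = a`, `b_k = b` and `(b_h, b_{h+1}) ∈ R` for all `h`. -/
def RChain {A : Type*} (R : Set (A × A)) (J : Set A) (a b : A) (k : ℕ) : Prop :=
  ∃ l : List A, l.length = k ∧ l.head? = some a ∧ l.getLast? = some b ∧
    (∀ c ∈ l, c ∈ J) ∧ l.Chain' (fun x y => (x, y) ∈ R)

theorem ML_base {A : Type*} {I : Set A} {R : Set (A × A)} {a : A} (ha : a ∈ I) :
    [a] ∈ MarkedLang I R := fun _ hL => hL.1 a ha

theorem ML_step {A : Type*} {I : Set A} {R : Set (A × A)} {w : List A}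
    (h : MarkedStep R (MarkedLang I R) w) : w ∈ MarkedLang I R := by
  intro L hL
  obtain ⟨a, b, x, y, hr, hx, hy, hw⟩ := h
  exact hL.2 w ⟨a, b, x, y, hr, hx L hL, hy L hL, hw⟩

theorem ML_sub {A : Type*} {I : Set A} {R : Set (A × A)} {L : Set (List A)}
    (h1 : ∀ a ∈ I, [a] ∈ L) (h2 : ∀ w, MarkedStep R L w → w ∈ L) :
    MarkedLang I R ⊆ L := fun _ hw => hw L ⟨h1, h2⟩

theorem WordConj_mem {A : Type*} {w w' : List A} (h : WordConj w w') (c : A) :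
    c ∈ w ↔ c ∈ w' := by
  obtain ⟨x, y, rfl, rfl⟩ := h
  simp [or_comm]

theorem ML_letters {A : Type*} (J : Set A) (R : Set (A × A)) :
    MarkedLang J R ⊆ {w | (∃ c, c ∈ w) ∧ ∀ c ∈ w, c ∈ J} := by
  apply ML_sub
  · intro a ha
    refine ⟨⟨a, by simp⟩, ?_⟩
    intro c hc
    rw [List.mem_singleton] at hc
    exact hc ▸ ha
  · rintro w ⟨a, b, x, y, hr, hx, hy, hw⟩
    refine ⟨⟨a, (WordConj_mem hw a).2 (by simp)⟩, ?_⟩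
    intro c hc
    rw [WordConj_mem hw c, List.append_assoc, List.mem_append] at hc
    rcases hc with hc | hc
    · exact hx.2 c hc
    · exact hy.2 c hc

/-- The circular language generated by a marked system `(I, R)` is the disjoint union
of the circular languages generated by the maximal transitive subsystems of its
canonical decomposition, given by the connected components `I_1, …, I_g` of the
associated graph. -/
theorem stmt6 {A : Type} [Fintype A] (I : Set A) (R : Set (A × A))
    (hsub : ∀ p ∈ R, p.1 ∈ I ∧ p.2 ∈ I)
    (hsym : ∀ a b : A, (a, b) ∈ R → (b, a) ∈ R)
    (hocc : ∀ a ∈ I, ∃ b, (a, b) ∈ R)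
    (g : ℕ) (Ih : Fin g → Set A)
    (hcover : (⋃ h, Ih h) = I)
    (hne : ∀ h, (Ih h).Nonempty)
    (hdisj : ∀ h h' : Fin g, h ≠ h' → Disjoint (Ih h) (Ih h'))
    (hconn : ∀ h, ∀ a ∈ Ih h, ∀ b ∈ Ih h, ∃ k, RChain R (Ih h) a b k)
    (hclosed : ∀ h, ∀ a ∈ Ih h, ∀ b : A, (a, b) ∈ R → b ∈ Ih h) :
    MarkedLang I R = (⋃ h, MarkedLang (Ih h) (R ∩ (Ih h ×ˢ Ih h))) ∧
      ∀ h h' : Fin g, h ≠ h' →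
        Disjoint (MarkedLang (Ih h) (R ∩ (Ih h ×ˢ Ih h)))
          (MarkedLang (Ih h') (R ∩ (Ih h' ×ˢ Ih h'))) := by
  constructor
  · apply Set.Subset.antisymm
    · apply ML_sub
      · intro a ha
        rw [← hcover] at ha
        obtain ⟨h, hh⟩ := Set.mem_iUnion.1 ha
        exact Set.mem_iUnion.2 ⟨h, ML_base hh⟩
      · rintro w ⟨a, b, x, y, hr, hx, hy, hw⟩
        obtain ⟨h, hx⟩ := Set.mem_iUnion.1 hx
        obtain ⟨h', hy⟩ := Set.mem_iUnion.1 hy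
        have ha : a ∈ Ih h := (ML_letters _ _ hx).2 a (by simp)
        have hb' : b ∈ Ih h' := (ML_letters _ _ hy).2 b (by simp)
        have hb : b ∈ Ih h := hclosed h a ha b hr
        have e : h = h' := by
          by_contra hne
          exact Set.disjoint_left.1 (hdisj h h' hne) hb hb'
        subst e
        exact Set.mem_iUnion.2 ⟨h, ML_step ⟨a, b, x, y, ⟨hr, ha, hb⟩, hx, hy, hw⟩⟩
    · apply Set.iUnion_subset
      intro h
      apply ML_sub
      · intro a ha
        exact ML_base (hcover ▸ Set.mem_iUnion.2 ⟨h, ha⟩)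
      · rintro w ⟨a, b, x, y, hr, hx, hy, hw⟩
        exact ML_step ⟨a, b, x, y, hr.1, hx, hy, hw⟩
  · intro h h' hne
    rw [Set.disjoint_left]
    intro w hw hw'
    obtain ⟨⟨c, hc⟩, h1⟩ := ML_letters _ _ hw
    exact Set.disjoint_left.1 (hdisj h h' hne) (h1 c hc) ((ML_letters _ _ hw').2 c hc)
end

section
/- Let S = (I,R) be a transitive marked system. The circular language L(I,R) generated by S is regular if and only if the local diameter of S satisfies δ_ℓ(S) ≤ 3. -/
/-- `J` is a transitive subset: the induced subgraph `G^J` is connected and either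
`|J| > 1` or `G^J` is a single vertex with a self-loop. -/
def IsTransitiveSubset {A : Type*} (R : Set (A × A)) (J : Set A) : Prop :=
  (∀ a ∈ J, ∀ b ∈ J, ∃ k, RChain R J a b k) ∧
    (1 < J.ncard ∨ ∃ a, J = {a} ∧ (a, a) ∈ R)

/-- The distance `d_J(a,b)`: the minimal length of a chain from `a` to `b` inside `J`. -/
noncomputable def markedDist {A : Type*} (R : Set (A × A)) (J : Set A) (a b : A) : ℕ :=
  sInf {k | RChain R J a b k}

/-- The global diameter `δ(S^J)` of the subsystem induced by `J`. -/
noncomputable def globalDiam {A : Type*} (R : Set (A × A)) (J : Set A) : ℕ :=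
  sSup {d | ∃ a ∈ J, ∃ b ∈ J, d = markedDist R J a b}

/-- The local diameter `δ_ℓ(S)`: the maximum of `δ(S^J)` over transitive subsets `J` of `I`. -/
noncomputable def localDiam {A : Type*} (R : Set (A × A)) (I : Set A) : ℕ :=
  sSup {d | ∃ J : Set A, J ⊆ I ∧ IsTransitiveSubset R J ∧ d = globalDiam R J}


namespace MS

theorem conj_symm {A : Type*} {w w' : List A} (h : WordConj w w') : WordConj w' w := by
  obtain ⟨x, y, h1, h2⟩ := h
  exact ⟨y, x, h2, h1⟩

theorem conj_trans {A : Type*} {w w' w'' : List A} (h : WordConj w w') (h' : WordConj w' w'') :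
    WordConj w w'' := by
  obtain ⟨x, y, rfl, rfl⟩ := h
  obtain ⟨z, t, h1, rfl⟩ := h'
  rcases List.append_eq_append_iff.1 h1 with ⟨c, rfl, rfl⟩ | ⟨c, rfl, rfl⟩
  · exact ⟨c, t ++ y, by simp, by simp⟩
  · exact ⟨x ++ z, c, by simp, by simp⟩

theorem lang_ind {A : Type*} {I : Set A} {R : Set (A × A)} (P : List A → Prop)
    (h1 : ∀ a ∈ I, P [a])
    (h2 : ∀ (a b : A) (x y w : List A), (a, b) ∈ R → P (x ++ [a]) → P (y ++ [b]) →
      WordConj w (x ++ [a] ++ y ++ [b]) → P w) {w : List A} (hw : w ∈ MarkedLang I R) : P w := by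
  refine hw {w | P w} ⟨h1, ?_⟩
  rintro w ⟨a, b, x, y, hab, hx, hy, hc⟩
  exact h2 a b x y w hab hx hy hc

theorem lang_single {A : Type*} {I : Set A} {R : Set (A × A)} {a : A} (ha : a ∈ I) :
    [a] ∈ MarkedLang I R := fun _ hL => hL.1 a ha

theorem lang_step {A : Type*} {I : Set A} {R : Set (A × A)} {a b : A} {x y w : List A}
    (hab : (a, b) ∈ R) (hx : x ++ [a] ∈ MarkedLang I R) (hy : y ++ [b] ∈ MarkedLang I R)
    (hc : WordConj w (x ++ [a] ++ y ++ [b])) : w ∈ MarkedLang I R :=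
  fun L hL => hL.2 w ⟨a, b, x, y, hab, hx L hL, hy L hL, hc⟩

theorem lang_conj {A : Type*} {I : Set A} {R : Set (A × A)} {w w' : List A}
    (hw : w ∈ MarkedLang I R) (hc : WordConj w' w) : w' ∈ MarkedLang I R := by
  have key : w ∈ MarkedLang I R ∧ ∀ w', WordConj w' w → w' ∈ MarkedLang I R := by
    refine lang_ind (fun w => w ∈ MarkedLang I R ∧ ∀ w', WordConj w' w → w' ∈ MarkedLang I R)
      ?_ ?_ hw
    · intro a ha
      refine ⟨lang_single ha, ?_⟩
      rintro w' ⟨x, y, rfl, h⟩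
      have : x ++ y = [a] := by
        rcases List.append_eq_singleton_iff.1 h.symm with ⟨rfl, rfl⟩ | ⟨rfl, rfl⟩ <;> simp
      rw [this]
      exact lang_single ha
    · intro a b x y w hab hx hy hc
      exact ⟨lang_step hab hx.1 hy.1 hc, fun w' h => lang_step hab hx.1 hy.1 (conj_trans h hc)⟩
  exact key.2 w' hc

theorem lang_insert {A : Type*} {I : Set A} {R : Set (A × A)} {p q : A} {u v : List A}
    (hp : p ∈ I) (hqp : (q, p) ∈ R) (h : u ++ q :: v ∈ MarkedLang I R) :
    u ++ q :: p :: v ∈ MarkedLang I R := by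
  have h1 : (v ++ u) ++ [q] ∈ MarkedLang I R :=
    lang_conj h ⟨v, u ++ [q], by simp, by simp⟩
  exact lang_step (y := []) hqp h1 (lang_single hp) ⟨u ++ [q, p], v, by simp, by simp⟩

theorem lang_star {A : Type*} {I : Set A} {R : Set (A × A)} {p : A} (hp : p ∈ I)
    (vs : List A) (hv : ∀ v ∈ vs, v ∈ I ∧ (p, v) ∈ R) : p :: vs ∈ MarkedLang I R := by
  induction vs with
  | nil => exact lang_single hp
  | cons v vs ih =>
    exact lang_insert (u := []) (hv v (by simp)).1 (hv v (by simp)).2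
      (ih fun x hx => hv x (by simp [hx]))

theorem find_adj {A : Type*} (U : Set A) (z : List A) : ∀ v : A, v ∉ U → (∃ x ∈ z, x ∈ U) →
    ∃ s q p t, v :: z = s ++ q :: p :: t ∧ q ∉ U ∧ p ∈ U := by
  induction z with
  | nil => rintro v hv ⟨x, hx, _⟩; simp at hx
  | cons y z ih =>
    rintro v hv ⟨x, hx, hxU⟩
    by_cases hy : y ∈ U
    · exact ⟨[], v, y, z, rfl, hv, hy⟩
    · have : x ∈ z := by
        rcases List.mem_cons.1 hx with rfl | h
        · exact absurd hxU hy
        · exact h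
      obtain ⟨s, q, p, t, h, hq, hp⟩ := ih y hy ⟨x, this, hxU⟩
      exact ⟨v :: s, q, p, t, by simp [h], hq, hp⟩

theorem lang_join {A : Type*} {I : Set A} {R : Set (A × A)}
    (hsym : ∀ a b : A, (a, b) ∈ R → (b, a) ∈ R) (U : Set A) (n : ℕ) : ∀ w : List A,
    w.length = n → (∀ x ∈ w, x ∈ I) → (∃ x ∈ w, x ∈ U) → (∃ x ∈ w, x ∉ U) →
    (∀ x ∈ w, ∀ y ∈ w, x ∈ U → y ∉ U → (x, y) ∈ R) → w ∈ MarkedLang I R := by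
  induction n with
  | zero => 
    rintro w hw _ ⟨x, hx, _⟩
    rw [List.length_eq_zero_iff.1 hw] at hx
    simp at hx
  | succ n ih =>
    rintro w hw hI ⟨x, hx, hxU⟩ ⟨v, hv, hvU⟩ hR
    obtain ⟨s0, t0, rfl⟩ := List.append_of_mem hv
    have hx' : x ∈ t0 ++ s0 := by
      have : x ≠ v := fun h => hvU (h ▸ hxU)
      simp at hx ⊢; tauto
    obtain ⟨s, q, p, t, h, hq, hp⟩ := find_adj U (t0 ++ s0) v hvU ⟨x, hx', hxU⟩
    have hmem : ∀ y, y ∈ s ++ q :: p :: t ↔ y ∈ s0 ++ v :: t0 := by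
      intro y; rw [← h]; simp; tauto
    have hlen : (s ++ q :: p :: t).length = n + 1 := by
      rw [← h, ← hw]; simp; omega
    have hc : WordConj (s0 ++ v :: t0) (s ++ q :: p :: t) := ⟨s0, v :: t0, rfl, by simp [← h]⟩
    simp only [← hmem] at hI hR
    refine lang_conj ?_ hc
    by_cases hU : ∃ x ∈ s ++ t, x ∈ U
    · obtain ⟨x, hx, hxU⟩ := hU
      have hsub : ∀ y, y ∈ s ++ q :: t → y ∈ s ++ q :: p :: t := by
        intro y; simp; tauto
      refine lang_insert (hI p (by simp)) (hsym _ _ (hR p (by simp) q (by simp) hp hq)) ?_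
      refine ih _ ?_ (fun y hy => hI y (hsub y hy)) ⟨x, ?_, hxU⟩ ⟨q, by simp, hq⟩
        (fun x hx y hy => hR x (hsub x hx) y (hsub y hy))
      · simp at hlen ⊢; omega
      · simp at hx ⊢; tauto
    · push Not at hU
      have h1 : p :: (t ++ s ++ [q]) ∈ MarkedLang I R := by
        refine lang_star (hI p (by simp)) _ fun y hy => ?_
        have hy1 : y ∈ s ++ q :: p :: t := by simp at hy ⊢; tauto
        refine ⟨hI y hy1, hR p (by simp) y hy1 hp ?_⟩
        simp only [List.mem_append, List.mem_singleton] at hy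
        rcases hy with (hy | hy) | rfl
        · exact hU y (by simp [hy])
        · exact hU y (by simp [hy])
        · exact hq
      exact lang_conj h1 ⟨s ++ [q], p :: t, by simp, by simp⟩

/-- no induced path on four vertices -/
def NoP4 {A : Type*} (r : A → A → Prop) : Prop :=
  ∀ a b c d, r a b → r b c → r c d → ¬ r a c → ¬ r a d → ¬ r b d → False

def Split {A : Type*} (r : A → A → Prop) (J : Finset A) : Prop :=
  ∃ U : Set A, (∃ x ∈ J, x ∈ U) ∧ (∃ x ∈ J, x ∉ U) ∧
    ∀ x ∈ J, ∀ y ∈ J, x ∈ U → y ∉ U → ¬ r x y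

theorem split_step {A : Type*} [DecidableEq A] (r : A → A → Prop) (hs : ∀ a b, r a b → r b a)
    (h4 : NoP4 r) (v : A) (K : Finset A) (hv : v ∉ K) (h : Split r K) :
    Split r (insert v K) ∨ Split (fun a b => ¬ r a b) (insert v K) := by
  obtain ⟨U, ⟨x, hx, hxU⟩, ⟨y, hy, hyU⟩, hU⟩ := h
  have hne : ∀ z ∈ K, z ≠ v := fun z hz h => hv (h ▸ hz)
  by_cases hM : ∀ z ∈ K, r v z
  · right
    refine ⟨{v}, ⟨v, by simp, rfl⟩, ⟨x, by simp [hx], hne x hx⟩, ?_⟩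
    rintro a - b hb rfl hb2
    have : b ∈ K := by
      rcases Finset.mem_insert.1 hb with h | h
      · exact absurd h hb2
      · exact h
    simpa using hM b this
  left
  push Not at hM
  obtain ⟨m, hm, hmv⟩ := hM
  by_cases hE : ∃ y ∈ K, ∃ z ∈ K, r v y ∧ ¬ r v z ∧ r y z
  · obtain ⟨b, hb, z, hz, hvb, hvz, hbz⟩ := hE
    by_cases hbU : b ∈ U
    · have hzU : z ∈ U := by
        by_contra h
        exact hU b hb z hz hbU h hbz
      refine ⟨Uᶜ \ {v}, ⟨y, by simp [hy], hyU, hne y hy⟩, ⟨v, by simp, by simp⟩, ?_⟩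
      rintro t ht s hsm ⟨htU, htv⟩ hsU hts
      have htK : t ∈ K := (Finset.mem_insert.1 ht).resolve_left htv
      rcases Finset.mem_insert.1 hsm with rfl | hsK
      · exact h4 t s b z hts hvb hbz (fun h => hU b hb t htK hbU htU (hs _ _ h))
          (fun h => hU z hz t htK hzU htU (hs _ _ h)) hvz
      · have : s ∈ U := by
          by_contra h
          exact hsU ⟨h, hne s hsK⟩
        exact hU s hsK t htK this htU (hs _ _ hts)
    · have hzU : z ∉ U := by
        intro h
        exact hU z hz b hb h hbU (hs _ _ hbz)
      refine ⟨U \ {v}, ⟨x, by simp [hx], hxU, hne x hx⟩, ⟨v, by simp, by simp⟩, ?_⟩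
      rintro t ht s hsm ⟨htU, htv⟩ hsU hts
      have htK : t ∈ K := (Finset.mem_insert.1 ht).resolve_left htv
      rcases Finset.mem_insert.1 hsm with rfl | hsK
      · exact h4 t s b z hts hvb hbz (fun h => hU t htK b hb htU hbU h)
          (fun h => hU t htK z hz htU hzU h) hvz
      · have : s ∉ U := fun h => hsU ⟨h, hne s hsK⟩
        exact hU t htK s hsK htU this hts
  · push Not at hE
    refine ⟨{z | z ≠ v ∧ ¬ r v z}, ⟨m, by simp [hm], hne m hm, hmv⟩, ⟨v, by simp, by simp⟩, ?_⟩
    rintro t ht s hsm ⟨htv, htr⟩ hsU hts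
    have htK : t ∈ K := (Finset.mem_insert.1 ht).resolve_left htv
    rcases Finset.mem_insert.1 hsm with rfl | hsK
    · exact htr (hs _ _ hts)
    · have : r v s := by
        by_contra h
        exact hsU ⟨hne s hsK, h⟩
      exact hE s hsK t htK this htr (hs _ _ hts)

theorem split_or {A : Type*} [DecidableEq A] (r : A → A → Prop) (hs : ∀ a b, r a b → r b a)
    (h4 : NoP4 r) (J : Finset A) : 2 ≤ J.card → Split r J ∨ Split (fun a b => ¬ r a b) J := by
  induction J using Finset.induction_on with
  | empty => simp
  | insert v K hv ih =>
    intro hc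
    rw [Finset.card_insert_of_notMem hv] at hc
    by_cases hK : 2 ≤ K.card
    · rcases ih hK with h | h
      · exact split_step r hs h4 v K hv h
      · have h4' : NoP4 (fun a b => ¬ r a b) := by
          intro a b c d h1 h2 h3 h5 h6 h7
          simp only [not_not] at h5 h6 h7
          exact h4 c a d b (hs _ _ h5) h6 (hs _ _ h7) h3 (fun h => h2 (hs _ _ h)) h1
        have := split_step (fun a b => ¬ r a b) (fun a b h h' => h (hs _ _ h')) h4' v K hv h
        simp only [not_not] at this
        exact this.symm
    · obtain ⟨u, rfl⟩ := Finset.card_eq_one.1 (show K.card = 1 by omega)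
      have huv : u ≠ v := by rintro rfl; simp at hv
      by_cases hr : r v u
      · right
        refine ⟨{v}, ⟨v, by simp, rfl⟩, ⟨u, by simp, huv⟩, ?_⟩
        rintro x hx y hy rfl hy2
        have : y = u := by simp at hy hy2; tauto
        subst this; simpa using hr
      · left
        refine ⟨{v}, ⟨v, by simp, rfl⟩, ⟨u, by simp, huv⟩, ?_⟩
        rintro x hx y hy rfl hy2
        have : y = u := by simp at hy hy2; tauto
        subst this; exact hr

/-- connectivity of the alphabet of a word -/
def Conn {A : Type*} (R : Set (A × A)) (w : List A) : Prop :=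
  ∀ U : Set A, (∃ x ∈ w, x ∈ U) → (∃ x ∈ w, x ∉ U) → ∃ x ∈ w, ∃ y ∈ w, x ∈ U ∧ y ∉ U ∧ (x, y) ∈ R

def Good {A : Type*} (I : Set A) (R : Set (A × A)) (w : List A) : Prop :=
  w ≠ [] ∧ (∀ x ∈ w, x ∈ I) ∧ Conn R w ∧ (w.length = 1 ∨ ∃ p ∈ w, ∃ q ∈ w, (p, q) ∈ R)

theorem lang_good {A : Type*} {I : Set A} {R : Set (A × A)}
    (hsym : ∀ a b : A, (a, b) ∈ R → (b, a) ∈ R) {w : List A} (hw : w ∈ MarkedLang I R) :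
    Good I R w := by
  refine lang_ind (Good I R) ?_ ?_ hw
  · intro a ha
    refine ⟨by simp, by simpa using ha, ?_, by simp⟩
    rintro U ⟨x, hx, hxU⟩ ⟨y, hy, hyU⟩
    simp at hx hy
    subst hx; subst hy
    exact absurd hxU hyU
  · rintro a b x y w hab ⟨-, hx1, hx2, -⟩ ⟨-, hy1, hy2, -⟩ ⟨s, t, rfl, h⟩
    have hmem : ∀ z, z ∈ s ++ t ↔ z ∈ x ++ [a] ∨ z ∈ y ++ [b] := by
      intro z
      have : z ∈ s ++ t ↔ z ∈ t ++ s := by simp; tauto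
      rw [this, ← h]; simp [or_assoc]
    have ha : a ∈ s ++ t := (hmem a).2 (by simp)
    have hb : b ∈ s ++ t := (hmem b).2 (by simp)
    refine ⟨List.ne_nil_of_mem ha, ?_, ?_, Or.inr ⟨a, ha, b, hb, hab⟩⟩
    · intro z hz
      rcases (hmem z).1 hz with h | h
      · exact hx1 z h
      · exact hy1 z h
    · rintro U ⟨p, hp, hpU⟩ ⟨q, hq, hqU⟩
      by_contra hno
      have e1 : ∀ z ∈ x ++ [a], (z ∈ U ↔ a ∈ U) := by
        intro z hz
        by_contra hne
        have : (∃ x' ∈ x ++ [a], x' ∈ U) ∧ (∃ x' ∈ x ++ [a], x' ∉ U) := by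
          by_cases hz2 : z ∈ U
          · exact ⟨⟨z, hz, hz2⟩, ⟨a, by simp, by tauto⟩⟩
          · exact ⟨⟨a, by simp, by tauto⟩, ⟨z, hz, hz2⟩⟩
        obtain ⟨c, hc, d, hd, h⟩ := hx2 U this.1 this.2
        exact hno ⟨c, (hmem c).2 (Or.inl hc), d, (hmem d).2 (Or.inl hd), h⟩
      have e2 : ∀ z ∈ y ++ [b], (z ∈ U ↔ b ∈ U) := by
        intro z hz
        by_contra hne
        have : (∃ x' ∈ y ++ [b], x' ∈ U) ∧ (∃ x' ∈ y ++ [b], x' ∉ U) := by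
          by_cases hz2 : z ∈ U
          · exact ⟨⟨z, hz, hz2⟩, ⟨b, by simp, by tauto⟩⟩
          · exact ⟨⟨b, by simp, by tauto⟩, ⟨z, hz, hz2⟩⟩
        obtain ⟨c, hc, d, hd, h⟩ := hy2 U this.1 this.2
        exact hno ⟨c, (hmem c).2 (Or.inr hc), d, (hmem d).2 (Or.inr hd), h⟩
      have e3 : a ∈ U ↔ b ∈ U := by
        by_contra hne
        by_cases haU : a ∈ U
        · exact hno ⟨a, ha, b, hb, haU, by tauto, hab⟩
        · exact hno ⟨b, hb, a, ha, by tauto, haU, hsym _ _ hab⟩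
      have e4 : ∀ z ∈ s ++ t, (z ∈ U ↔ a ∈ U) := by
        intro z hz
        rcases (hmem z).1 hz with h | h
        · exact e1 z h
        · rw [e2 z h, e3]
      have := e4 p hp
      have := e4 q hq
      tauto

theorem good_lang {A : Type*} {I : Set A} {R : Set (A × A)}
    (hsym : ∀ a b : A, (a, b) ∈ R → (b, a) ∈ R) (h4 : NoP4 (fun a b => (a, b) ∈ R))
    {w : List A} (hw : Good I R w) : w ∈ MarkedLang I R := by
  classical
  obtain ⟨hne, hI, hC, hE⟩ := hw
  by_cases hc : 2 ≤ w.toFinset.card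
  · rcases split_or _ hsym h4 w.toFinset hc with ⟨U, h1, h2, h3⟩ | ⟨U, h1, h2, h3⟩
    · simp only [List.mem_toFinset] at h1 h2 h3
      obtain ⟨x, hx, y, hy, hxU, hyU, hxy⟩ := hC U h1 h2
      exact absurd hxy (h3 x hx y hy hxU hyU)
    · simp only [List.mem_toFinset, not_not] at h1 h2 h3
      exact lang_join hsym U _ w rfl hI h1 h2 h3
  · cases w with
    | nil => exact absurd rfl hne
    | cons p vs =>
      have hall : ∀ v ∈ p :: vs, v = p := by
        intro v hv
        by_contra h
        apply hc
        exact Finset.one_lt_card.2 ⟨v, by simpa using hv, p, by simp, h⟩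
      rcases hE with hE | ⟨a, ha, b, hb, hab⟩
      · have : vs = [] := by simpa using hE
        subst this
        exact lang_single (hI p (by simp))
      · rw [hall a ha, hall b hb] at hab
        refine lang_star (hI p (by simp)) vs fun v hv => ?_
        rw [hall v (by simp [hv])]
        exact ⟨hI p (by simp), hab⟩

theorem regular_of_noP4 {A : Type} [Fintype A] {I : Set A} {R : Set (A × A)}
    (hsym : ∀ a b : A, (a, b) ∈ R → (b, a) ∈ R) (h4 : NoP4 (fun a b => (a, b) ∈ R)) :
    Language.IsRegular (MarkedLang I R : Language A) := by
  have hiff : ∀ w, w ∈ MarkedLang I R ↔ Good I R w :=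
    fun w => ⟨lang_good hsym, good_lang hsym h4⟩
  refine Language.isRegular_iff_finite_range_leftQuotient.2 ?_
  let φ : List A → Set A × Fin 3 := fun w => ({x | x ∈ w}, ⟨min w.length 2, by omega⟩)
  have hφ : ∀ x y, φ x = φ y → Language.leftQuotient (MarkedLang I R : Language A) x =
      Language.leftQuotient (MarkedLang I R : Language A) y := by
    intro x y hxy
    have h1 : ∀ z, z ∈ x ↔ z ∈ y := by
      intro z
      have := congrArg Prod.fst hxy
      exact Set.ext_iff.1 this z
    have h2 : min x.length 2 = min y.length 2 := by
      have := congrArg Prod.snd hxy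
      simpa [φ] using this
    ext z
    change x ++ z ∈ MarkedLang I R ↔ y ++ z ∈ MarkedLang I R
    rw [hiff, hiff]
    have h3 : ∀ t, t ∈ x ++ z ↔ t ∈ y ++ z := by intro t; simp [h1]
    have h4 : (x ++ z).length = 1 ↔ (y ++ z).length = 1 := by simp; omega
    have h5 : (x ++ z) ≠ [] ↔ (y ++ z) ≠ [] := by
      rw [← List.length_pos_iff_ne_nil, ← List.length_pos_iff_ne_nil]; simp; omega
    unfold Good Conn
    simp only [h3, h4, h5]
  have : Set.range (Language.leftQuotient (MarkedLang I R : Language A)) ⊆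
      Set.range (fun s : Set.range φ =>
        Language.leftQuotient (MarkedLang I R : Language A) s.2.choose) := by
    rintro _ ⟨x, rfl⟩
    refine ⟨⟨φ x, x, rfl⟩, ?_⟩
    apply hφ
    exact (Set.mem_range_self (f := φ) x).choose_spec
  exact (Set.finite_range _).subset this

def hAlt {A : Type*} (X : A → Bool) : Bool → List A → ℕ
  | _, [] => 0
  | p, x :: t => (if p = true ∧ X x = false then 1 else 0) + hAlt X (X x) t

theorem hAlt_append {A : Type*} (X : A → Bool) (x z : List A) (a : A) : ∀ p,
    hAlt X p (x ++ a :: z) = hAlt X p (x ++ [a]) + hAlt X (X a) z := by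
  induction x with
  | nil => intro p; simp [hAlt]
  | cons y x ih => intro p; simp [hAlt, ih, add_assoc]

theorem hAlt_le {A : Type*} (X : A → Bool) (z : List A) :
    hAlt X false z ≤ hAlt X true z ∧ hAlt X true z ≤ hAlt X false z + 1 := by
  cases z with
  | nil => simp [hAlt]
  | cons y z => simp only [hAlt]; constructor <;> split_ifs <;> simp_all <;> omega

theorem hAlt_le' {A : Type*} (X : A → Bool) (z : List A) (p q : Bool) :
    hAlt X p z ≤ hAlt X q z + 1 := by
  have := hAlt_le X z
  cases p <;> cases q <;> omega

theorem inv {A : Type*} {I : Set A} {R : Set (A × A)} (X B : A → Bool) (J : Set A)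
    (hJ : ∀ u ∈ J, ∀ v ∈ J, (u, v) ∈ R → X u = X v ∨ (B u = true ∧ B v = true))
    {w : List A} (hw : w ∈ MarkedLang I R) :
    ∀ x p, w = x ++ [p] → (∀ z ∈ w, z ∈ J) →
      hAlt X (X p) w = 0 ∨ hAlt X (X p) w + 1 ≤ w.countP B := by
  refine lang_ind (fun w => ∀ x p, w = x ++ [p] → (∀ z ∈ w, z ∈ J) →
      hAlt X (X p) w = 0 ∨ hAlt X (X p) w + 1 ≤ w.countP B) ?_ ?_ hw
  · rintro a - x p h -
    rcases List.append_eq_singleton_iff.1 h.symm with ⟨rfl, h2⟩ | ⟨rfl, h2⟩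
    · simp at h2; subst h2; left; simp [hAlt]
    · simp at h2
  · rintro a b x y w hab hx hy ⟨s, t, rfl, h⟩ z p hz hall
    have hx := hx x a rfl
    have hy := hy y b rfl
    have hmem : ∀ z, z ∈ x ++ [a] ∨ z ∈ y ++ [b] → z ∈ s ++ t := by
      intro z hz
      have : z ∈ s ++ t ↔ z ∈ t ++ s := by simp; tauto
      rw [this, ← h]; simpa [or_assoc] using hz
    have hx := hx fun z hz => hall z (hmem z (Or.inl hz))
    have hy := hy fun z hz => hall z (hmem z (Or.inr hz))
    have hcnt : (s ++ t).countP B = (x ++ [a]).countP B + (y ++ [b]).countP B := by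
      have : (s ++ t).countP B = (t ++ s).countP B := by simp [add_comm]
      rw [this, ← h, List.append_assoc (x ++ [a]), List.countP_append]
    have hcyc : hAlt X (X p) (s ++ t) = hAlt X (X b) (x ++ [a]) + hAlt X (X a) (y ++ [b]) := by
      have e : hAlt X (X b) (x ++ [a] ++ y ++ [b]) =
          hAlt X (X b) (x ++ [a]) + hAlt X (X a) (y ++ [b]) := by
        rw [← hAlt_append]; simp
      rw [← e, h]
      rcases List.eq_nil_or_concat t with rfl | ⟨t', q, rfl⟩
      · have : s = (x ++ [a] ++ y) ++ [b] := by simpa using h.symm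
        have h2 : p = b := by
          have h3 := hz.symm.trans (List.append_nil s)
          rw [this] at h3
          simpa using (List.append_inj' h3 rfl).2
        simp [h2]
      · have hpq : p = q := by
          rw [List.concat_eq_append, ← List.append_assoc] at hz
          simpa using (List.append_inj' hz rfl).2.symm
        subst hpq
        rcases List.eq_nil_or_concat s with rfl | ⟨s', q, rfl⟩
        · have h2 : p = b := by
            have h3 := h
            rw [List.concat_eq_append, List.append_nil] at h3
            simpa using (List.append_inj' h3 rfl).2.symm
          simp [h2]
        · have hbq : b = q := by
            have h3 := h
            rw [List.concat_eq_append, List.concat_eq_append, ← List.append_assoc] at h3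
            simpa using (List.append_inj' h3 rfl).2
          subst hbq
          simp only [List.concat_eq_append, List.append_assoc, List.cons_append, List.nil_append]
          rw [hAlt_append X s' (t' ++ [p]), hAlt_append X t' (s' ++ [b])]
          omega
    rw [hcnt, hcyc]
    rcases hJ a (hall a (hmem a (by simp))) b (hall b (hmem b (by simp))) hab with h1 | ⟨h1, h2⟩
    · rw [h1] at hx ⊢
      omega
    · have c1 : 1 ≤ (x ++ [a]).countP B := by simp [h1]
      have c2 : 1 ≤ (y ++ [b]).countP B := by simp [h2]
      right
      cases ha : X a <;> cases hb : X b <;> rw [ha] at hx <;> rw [hb] at hy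
      · omega
      · have := hAlt_le X (x ++ [a]); have := hAlt_le X (y ++ [b]); omega
      · have := hAlt_le X (x ++ [a]); have := hAlt_le X (y ++ [b]); omega
      · omega

/-- the word `(ab)^n` -/
def pw {A : Type*} (a b : A) : ℕ → List A
  | 0 => []
  | n + 1 => a :: b :: pw a b n

theorem pw_succ' {A : Type*} (a b : A) (n : ℕ) : pw a b (n + 1) = pw a b n ++ [a, b] := by
  induction n with
  | zero => rfl
  | succ n ih =>
    rw [pw, ih]
    conv_rhs => rw [← ih]
    conv_rhs => rw [pw]
    simp

theorem noP4_of_regular {A : Type} {I : Set A} {R : Set (A × A)}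
    (hsub : ∀ p ∈ R, p.1 ∈ I ∧ p.2 ∈ I)
    (hsym : ∀ a b : A, (a, b) ∈ R → (b, a) ∈ R)
    (hreg : Language.IsRegular (MarkedLang I R : Language A)) :
    NoP4 (fun a b => (a, b) ∈ R) := by
  classical
  intro a b c d hab hbc hcd hac had hbd
  have haI := (hsub _ hab).1
  have hbI := (hsub _ hab).2
  have hcI := (hsub _ hbc).2
  have hdI := (hsub _ hcd).2
  have nac : a ≠ c := by rintro rfl; exact had hcd
  have nad : a ≠ d := by rintro rfl; exact hac (hsym _ _ hcd)
  have nbc : b ≠ c := by rintro rfl; exact hac hab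
  have nbd : b ≠ d := by rintro rfl; exact had hab
  have nab : a ≠ b := by rintro rfl; exact hac hbc
  have ncd : c ≠ d := by rintro rfl; exact hbd hbc
  have mem : ∀ n, pw c b (n + 1) ++ pw a d (n + 1) ∈ MarkedLang I R := by
    intro n
    induction n with
    | zero =>
      have h0 : [] ++ c :: [] ∈ MarkedLang I R := lang_single hcI
      have h1 := lang_insert hdI hcd h0
      have h2 := lang_insert hbI (hsym _ _ hbc) h1
      exact lang_insert (u := [c]) haI (hsym _ _ hab) h2
    | succ n ih =>
      rw [pw_succ' c b n] at ih
      have h0 : (pw c b n ++ [c]) ++ b :: pw a d (n + 1) ∈ MarkedLang I R := by simpa using ih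
      have h1 := lang_insert hcI hbc h0
      have h2 : (pw c b n ++ [c, b]) ++ c :: pw a d (n + 1) ∈ MarkedLang I R := by simpa using h1
      have h3 := lang_insert hbI (hsym _ _ hbc) (lang_insert hdI hcd h2)
      have h4 : (pw c b n ++ [c, b, c]) ++ b :: d :: pw a d (n + 1) ∈ MarkedLang I R := by
        simpa using h3
      have h5 := lang_insert haI (hsym _ _ hab) h4
      rw [pw_succ' c b (n + 1), pw_succ' c b n]
      simpa [pw] using h5
  let X : A → Bool := fun x => decide (x = a ∨ x = b)
  let B : A → Bool := fun x => decide (x = b ∨ x = c)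
  have Xa : X a = true := by simp [X]
  have Xb : X b = true := by simp [X]
  have Xc : X c = false := by simp [X, nac.symm, nbc.symm]
  have Xd : X d = false := by simp [X, nad.symm, nbd.symm]
  have Ba : B a = false := by simp [B, nab, nac]
  have Bb : B b = true := by simp [B]
  have Bc : B c = true := by simp [B]
  have Bd : B d = false := by simp [B, nbd.symm, ncd.symm]
  have hJ : ∀ u ∈ ({a, b, c, d} : Set A), ∀ v ∈ ({a, b, c, d} : Set A), (u, v) ∈ R →
      X u = X v ∨ (B u = true ∧ B v = true) := by
    intro u hu v hv huv
    simp only [Set.mem_insert_iff, Set.mem_singleton_iff] at hu hv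
    have hca := fun h => hac (hsym c a h)
    have hda := fun h => had (hsym d a h)
    have hdb := fun h => hbd (hsym d b h)
    rcases hu with rfl | rfl | rfl | rfl <;> rcases hv with rfl | rfl | rfl | rfl <;>
      simp_all
  have pmem : ∀ n, ∀ p q z : A, z ∈ pw p q n → z = p ∨ z = q := by
    intro n p q z
    induction n with
    | zero => simp [pw]
    | succ n ih => simp only [pw, List.mem_cons]; tauto
  have had' : ∀ j p, hAlt X p (pw a d j) = j := by
    intro j
    induction j with
    | zero => intro p; rfl
    | succ j ih => intro p; simp [pw, hAlt, Xa, Xd, ih]; omega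
  have hcb : ∀ i j, hAlt X true (pw c b i ++ pw a d j) = i + j := by
    intro i j
    induction i with
    | zero => simp [pw, had']
    | succ i ih => simp [pw, hAlt, Xb, Xc, ih]; omega
  have cnt : ∀ i j, (pw c b i ++ pw a d j).countP B = 2 * i := by
    intro i j
    rw [List.countP_append]
    have e1 : ∀ i, (pw c b i).countP B = 2 * i := by
      intro i
      induction i with
      | zero => rfl
      | succ i ih => simp [pw, Bb, Bc, ih]; omega
    have e2 : ∀ i, (pw a d i).countP B = 0 := by
      intro i
      induction i with
      | zero => rfl
      | succ i ih => simpa [pw, Ba, Bd] using ih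
    rw [e1, e2]; rfl
  have nmem : ∀ i j, i < j → pw c b i ++ pw a d j ∉ MarkedLang I R := by
    intro i j hij hmem
    obtain ⟨j, rfl⟩ : ∃ k, j = k + 1 := ⟨j - 1, by omega⟩
    have := inv X B {a, b, c, d} hJ hmem (pw c b i ++ pw a d j ++ [a]) d
      (by rw [pw_succ']; simp) (by
        intro z hz
        simp only [Set.mem_insert_iff, Set.mem_singleton_iff]
        rcases List.mem_append.1 hz with h | h
        · have := pmem _ _ _ _ h; tauto
        · have := pmem _ _ _ _ h; tauto)
    rw [cnt, Xd] at this
    have h1 := (hAlt_le X (pw c b i ++ pw a d (j + 1))).2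
    rw [hcb] at h1
    rcases this with h | h
    · have : i = 0 ∧ j = 0 := by omega
      obtain ⟨rfl, rfl⟩ := this
      have := had' 1 false
      simp [pw] at this h
      omega
    · omega
  replace hreg := Language.isRegular_iff_finite_range_leftQuotient.1 hreg
  have hninj : ¬ Function.Injective
      (fun n : ℕ => Language.leftQuotient (MarkedLang I R : Language A) (pw c b n)) := by
    intro hinj
    exact Set.infinite_range_of_injective hinj
      (hreg.subset (by rintro _ ⟨n, rfl⟩; exact ⟨_, rfl⟩))
  have key : ∀ i j, i < j → Language.leftQuotient (MarkedLang I R : Language A) (pw c b i) ≠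
      Language.leftQuotient (MarkedLang I R : Language A) (pw c b j) := by
    intro i j hij he
    apply nmem i j hij
    obtain ⟨k, rfl⟩ : ∃ k, j = k + 1 := ⟨j - 1, by omega⟩
    have h1 : pw a d (k + 1) ∈
        Language.leftQuotient (MarkedLang I R : Language A) (pw c b (k + 1)) := mem k
    rw [← he] at h1
    exact h1
  apply hninj
  intro i j hij
  rcases lt_trichotomy i j with h | h | h
  · exact absurd hij (key i j h)
  · exact h
  · exact absurd hij.symm (key j i h)

theorem diam_of_noP4 {A : Type} {I : Set A} {R : Set (A × A)}
    (h4 : NoP4 (fun a b => (a, b) ∈ R)) : localDiam R I ≤ 3 := by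
  refine csSup_le' ?_
  rintro _ ⟨J, hJI, hJ, rfl⟩
  refine csSup_le' ?_
  rintro _ ⟨a, ha, b, hb, rfl⟩
  by_contra hlt
  have hmin : ∀ k, RChain R J a b k → markedDist R J a b ≤ k := fun k hk => Nat.sInf_le hk
  have hch : RChain R J a b (markedDist R J a b) := Nat.sInf_mem (hJ.1 a ha b hb)
  generalize markedDist R J a b = n at *
  obtain ⟨l, hl, hh, hlast, hm, hc⟩ := hch
  match l, hl, hh, hlast, hm, hc with
  | [], hl, _, _, _, _ => simp at hl; omega
  | [_], hl, _, _, _, _ => simp at hl; omega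
  | [_, _], hl, _, _, _, _ => simp at hl; omega
  | [_, _, _], hl, _, _, _, _ => simp at hl; omega
  | p :: q :: r :: s :: t, hl, hh, hlast, hm, hc =>
    simp only [List.length_cons] at hl
    change List.IsChain _ _ at hc
    simp only [List.isChain_cons_cons] at hc
    obtain ⟨c1, c2, c3, c4⟩ := hc
    have hh : p = a := by simpa using hh
    subst hh
    refine h4 p q r s c1 c2 c3 ?_ ?_ ?_
    · intro h
      have := hmin (t.length + 3) ⟨p :: r :: s :: t, by simp, rfl, by simpa using hlast,
        fun c hc => hm c (by simp at hc ⊢; tauto), by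
          change List.IsChain _ _
          simp only [List.isChain_cons_cons]; tauto⟩
      omega
    · intro h
      have := hmin (t.length + 2) ⟨p :: s :: t, by simp, rfl, by simpa using hlast,
        fun c hc => hm c (by simp at hc ⊢; tauto), by
          change List.IsChain _ _
          simp only [List.isChain_cons_cons]; tauto⟩
      omega
    · intro h
      have := hmin (t.length + 3) ⟨p :: q :: s :: t, by simp, rfl, by simpa using hlast,
        fun c hc => hm c (by simp at hc ⊢; tauto), by
          change List.IsChain _ _
          simp only [List.isChain_cons_cons]; tauto⟩
      omega

theorem noP4_of_diam {A : Type} [Fintype A] {I : Set A} {R : Set (A × A)}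
    (hsub : ∀ p ∈ R, p.1 ∈ I ∧ p.2 ∈ I)
    (hsym : ∀ a b : A, (a, b) ∈ R → (b, a) ∈ R)
    (hd : localDiam R I ≤ 3) : NoP4 (fun a b => (a, b) ∈ R) := by
  intro a b c d hab hbc hcd hac had hbd
  have haI := (hsub _ hab).1
  have hbI := (hsub _ hab).2
  have hcI := (hsub _ hbc).2
  have hdI := (hsub _ hcd).2
  have nad : a ≠ d := by rintro rfl; exact hac (hsym _ _ hcd)
  have hba := hsym _ _ hab
  have hcb := hsym _ _ hbc
  have hdc := hsym _ _ hcd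
  let J : Set A := {a, b, c, d}
  have hch : ∀ l : List A, ∀ x y, l.head? = some x → l.getLast? = some y →
      (∀ z ∈ l, z ∈ J) → l.IsChain (fun x y => (x, y) ∈ R) → ∃ k, RChain R J x y k :=
    fun l x y h1 h2 h3 h4 => ⟨l.length, l, rfl, h1, h2, h3, h4⟩
  have hJt : IsTransitiveSubset R J := by
    refine ⟨?_, Or.inl ?_⟩
    · intro x hx y hy
      rcases hx with rfl | rfl | rfl | rfl <;> rcases hy with rfl | rfl | rfl | rfl
      · exact hch [_] _ _ rfl rfl (by simp [J]) (by simp)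
      · exact hch [x, y] _ _ rfl rfl (by simp [J]) (by simp [*])
      · exact hch [x, b, y] _ _ rfl rfl (by simp [J]) (by simp [*])
      · exact hch [x, b, c, y] _ _ rfl rfl (by simp [J]) (by simp [*])
      · exact hch [x, y] _ _ rfl rfl (by simp [J]) (by simp [*])
      · exact hch [_] _ _ rfl rfl (by simp [J]) (by simp)
      · exact hch [x, y] _ _ rfl rfl (by simp [J]) (by simp [*])
      · exact hch [x, c, y] _ _ rfl rfl (by simp [J]) (by simp [*])
      · exact hch [x, b, y] _ _ rfl rfl (by simp [J]) (by simp [*])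
      · exact hch [x, y] _ _ rfl rfl (by simp [J]) (by simp [*])
      · exact hch [_] _ _ rfl rfl (by simp [J]) (by simp)
      · exact hch [x, y] _ _ rfl rfl (by simp [J]) (by simp [*])
      · exact hch [x, c, b, y] _ _ rfl rfl (by simp [J]) (by simp [*])
      · exact hch [x, c, y] _ _ rfl rfl (by simp [J]) (by simp [*])
      · exact hch [x, y] _ _ rfl rfl (by simp [J]) (by simp [*])
      · exact hch [_] _ _ rfl rfl (by simp [J]) (by simp)
    · rw [Set.one_lt_ncard (Set.toFinite J)]
      exact ⟨a, by simp [J], d, by simp [J], nad⟩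
  have hdist : 4 ≤ markedDist R J a d := by
    have : RChain R J a d (markedDist R J a d) :=
      Nat.sInf_mem (hJt.1 a (by simp [J]) d (by simp [J]))
    generalize markedDist R J a d = n at *
    obtain ⟨l, hl, hh, hlast, hm, hc⟩ := this
    by_contra hlt
    match l, hl, hh, hlast, hm, hc with
    | [], hl, hh, _, _, _ => simp at hh
    | [p], hl, hh, hlast, _, _ =>
      simp at hh hlast
      exact nad (hh.symm.trans hlast)
    | [p, q], hl, hh, hlast, _, hc =>
      change List.IsChain _ _ at hc
      simp at hh hlast hc
      subst hh; subst hlast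
      exact had hc
    | [p, x, q], hl, hh, hlast, hm, hc =>
      change List.IsChain _ _ at hc
      simp at hh hlast hc
      subst hh; subst hlast
      rcases hm x (by simp) with rfl | rfl | rfl | rfl
      · exact had hc.2
      · exact hbd hc.2
      · exact hac hc.1
      · exact had hc.1
    | p :: q :: r :: s :: t, hl, hh, hlast, hm, hc =>
      simp at hl; omega
  have hg : markedDist R J a d ≤ globalDiam R J := by
    refine le_csSup (Set.Finite.bddAbove ?_) ⟨a, by simp [J], d, by simp [J], rfl⟩
    refine (Set.finite_range (fun p : A × A => markedDist R J p.1 p.2)).subset ?_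
    rintro _ ⟨x, _, y, _, rfl⟩
    exact ⟨(x, y), rfl⟩
  have hl : globalDiam R J ≤ localDiam R I := by
    refine le_csSup (Set.Finite.bddAbove ?_) ⟨J, ?_, hJt, rfl⟩
    · refine (Set.finite_range (fun J : Set A => globalDiam R J)).subset ?_
      rintro _ ⟨x, _, _, rfl⟩
      exact ⟨x, rfl⟩
    · rintro x (rfl | rfl | rfl | rfl) <;> assumption
  omega

end MS

/-- A transitive marked system `(I, R)` generates a regular circular language if and
only if its local diameter is at most 3. -/
theorem stmt7 {A : Type} [Fintype A] (I : Set A) (R : Set (A × A))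
    (hsub : ∀ p ∈ R, p.1 ∈ I ∧ p.2 ∈ I)
    (hsym : ∀ a b : A, (a, b) ∈ R → (b, a) ∈ R)
    (hocc : ∀ a ∈ I, ∃ b, (a, b) ∈ R)
    (htrans : IsTransitiveSubset R I) :
    Language.IsRegular (MarkedLang I R : Language A) ↔ localDiam R I ≤ 3 := by
  exact ⟨fun h => MS.diam_of_noP4 (MS.noP4_of_regular hsub hsym h),
    fun h => MS.regular_of_noP4 hsym (MS.noP4_of_diam hsub hsym h)⟩
end

section
/- Let S = (I,R) be a transitive marked system. If the local diameter satisfies δ_ℓ(S) > 3, then the circular language L(I,R) is not regular (its full linearization is not a regular language). -/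
def altc {A : Type} (t : A → Bool) : A → List A → ℕ
  | _, [] => 0
  | p, x :: l => (if t p = t x then 0 else 1) + altc t x l

theorem altc_append {A : Type} (t : A → Bool) (l m : List A) (p q : A) :
    altc t p (l ++ [q] ++ m) = altc t p (l ++ [q]) + altc t q m := by
  induction l generalizing p with
  | nil => simp [altc]
  | cons x l ih =>
    have := ih x
    simp only [List.cons_append, altc] at *
    omega

theorem altc_congr {A : Type} (t : A → Bool) (l : List A) (p q : A) (h : t p = t q) :
    altc t p l = altc t q l := by
  cases l <;> simp [altc, h]

theorem altc_le {A : Type} (t : A → Bool) (l : List A) (p q : A) :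
    altc t p l ≤ altc t q l + 1 := by
  cases l with
  | nil => simp [altc]
  | cons x l => simp only [altc]; split_ifs <;> omega

/-- the invariant -/
def AltInv {A : Type} (J : A → Prop) (t k : A → Bool) (w : List A) : Prop :=
  ∀ x a, w = x ++ [a] → (∀ c ∈ w, J c) → altc t a w ≤ 2 * (w.countP k - 1)

theorem AltInv_conj {A : Type} (J : A → Prop) (t k : A → Bool) (w w' : List A)
    (h : WordConj w w') (hw : AltInv J t k w') : AltInv J t k w := by
  obtain ⟨x, y, rfl, rfl⟩ := h
  rcases List.eq_nil_or_concat x with rfl | ⟨x, p, rfl⟩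
  · simpa using hw
  rcases List.eq_nil_or_concat y with rfl | ⟨y, q, rfl⟩
  · simpa using hw
  intro z a hz hJ
  have ha : a = q := by
    have h2 : (x.concat p ++ y) ++ [q] = z ++ [a] := by rw [← hz]; simp
    simpa using (List.append_inj' h2 rfl).2.symm
  subst ha
  have h1 := hw (y ++ [a] ++ x) p (by simp) (by
    intro c hc; apply hJ; simp at hc ⊢; tauto)
  simp only [List.concat_eq_append] at *
  have e1 := altc_append t x (y ++ [a]) a p
  have e2 := altc_append t y (x ++ [p]) p a
  simp only [List.countP_append] at *
  rw [e1]
  rw [e2] at h1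
  omega

theorem AltInv_lang {A : Type} (I : Set A) (R : Set (A × A)) (J : A → Prop) (t k : A → Bool)
    (hR : ∀ a b, J a → J b → (a, b) ∈ R → t a ≠ t b → k a = true ∧ k b = true)
    (w : List A) (hw : w ∈ MarkedLang I R) : AltInv J t k w := by
  refine hw {w | AltInv J t k w} ⟨?_, ?_⟩
  · intro a _ x b hx _
    have : a = b := by
      have := congrArg List.getLast? hx
      simpa using this
    subst this
    simp [altc]
  · rintro w ⟨a, b, x, y, hab, hx, hy, hc⟩
    refine AltInv_conj J t k _ _ hc ?_
    intro z b' hz hJ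
    have : b' = b := by
      simpa using (List.append_inj' hz rfl).2.symm
    subst this
    have h1 := hx x a rfl (fun c hc => hJ c (by simp at hc ⊢; tauto))
    have h2 := hy y b' rfl (fun c hc => hJ c (by simp at hc ⊢; tauto))
    have e1 := altc_append t x (y ++ [b']) b' a
    have hJa : J a := hJ a (by simp)
    have hJb : J b' := hJ b' (by simp)
    rw [← List.append_assoc] at e1
    rw [e1]
    simp only [List.countP_append] at *
    by_cases ht : t a = t b'
    · rw [altc_congr t _ _ _ ht.symm, altc_congr t (y ++ [b']) _ _ ht]
      omega
    · obtain ⟨ka, kb⟩ := hR a b' hJa hJb hab ht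
      have i1 := altc_le t (x ++ [a]) b' a
      have i2 := altc_le t (y ++ [b']) a b'
      simp [ka, kb] at *
      omega

theorem lang_step {A : Type} {I : Set A} {R : Set (A × A)} {w : List A}
    (h : MarkedStep R (MarkedLang I R) w) : w ∈ MarkedLang I R := by
  intro L hL
  refine hL.2 w ?_
  obtain ⟨a, b, x, y, h1, h2, h3, h4⟩ := h
  exact ⟨a, b, x, y, h1, h2 L hL, h3 L hL, h4⟩

theorem lang_single {A : Type} {I : Set A} {R : Set (A × A)} {a : A} (h : a ∈ I) :
    [a] ∈ MarkedLang I R := fun _ hL => hL.1 a h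

theorem lang_snoc {A : Type} {I : Set A} {R : Set (A × A)} {w : List A} {q p : A}
    (hw : w ++ [q] ∈ MarkedLang I R) (hp : p ∈ I) (h : (q, p) ∈ R) :
    w ++ [q] ++ [p] ∈ MarkedLang I R :=
  lang_step ⟨q, p, w, [], h, hw, lang_single hp, [], _, rfl, by simp⟩

theorem lang_cons {A : Type} {I : Set A} {R : Set (A × A)} {w : List A} {q p : A}
    (hw : w ++ [q] ∈ MarkedLang I R) (hp : p ∈ I) (h : (q, p) ∈ R) :
    p :: (w ++ [q]) ∈ MarkedLang I R :=
  lang_step ⟨q, p, w, [], h, hw, lang_single hp, [p], w ++ [q], rfl, by simp⟩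

/-- `(xy)^n` -/
def pw {A : Type} (x y : A) : ℕ → List A
  | 0 => []
  | n + 1 => x :: y :: pw x y n

theorem pw_succ {A : Type} (x y : A) (n : ℕ) : pw x y (n + 1) = pw x y n ++ [x, y] := by
  induction n with
  | zero => rfl
  | succ n ih =>
    change x :: y :: pw x y (n + 1) = (x :: y :: pw x y n) ++ [x, y]
    rw [ih]
    rfl

theorem lang_mem {A : Type} {I : Set A} {R : Set (A × A)} {a b c d : A}
    (ha : a ∈ I) (hb : b ∈ I) (hc : c ∈ I) (hd : d ∈ I)
    (hba : (b, a) ∈ R) (hbc : (b, c) ∈ R) (hcb : (c, b) ∈ R) (hcd : (c, d) ∈ R) (n : ℕ) :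
    pw a d n ++ (pw c b n ++ [c]) ∈ MarkedLang I R := by
  induction n with
  | zero => exact lang_single hc
  | succ n ih =>
    rw [← List.append_assoc] at ih
    have h1 := lang_cons ih hd hcd
    rw [← List.cons_append] at h1
    have h2 := lang_snoc h1 hb hcb
    have h3 := lang_cons h2 ha hba
    rw [← List.cons_append] at h3
    have h4 := lang_snoc h3 hc hbc
    rw [pw_succ c b]
    simpa [pw] using h4

theorem altc_pw {A : Type} (t : A → Bool) {a d : A} (ta : t a = false) (td : t d = true)
    (m : ℕ) (l : List A) (p : A) (tp : t p = true) :
    altc t p (pw a d m ++ l) = 2 * m + altc t d l := by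
  induction m generalizing p with
  | zero => simp [pw]; exact altc_congr t l p d (by rw [tp, td])
  | succ m ih => simp [pw, altc, ta, td, tp, ih d td]; omega

theorem altc_pw2 {A : Type} (t : A → Bool) {c b : A} (tc : t c = true) (tb : t b = false)
    (n : ℕ) (p : A) :
    altc t p (pw c b n ++ [c]) = 2 * n + (if t p = true then 0 else 1) := by
  induction n generalizing p with
  | zero => simp [pw, altc, tc]
  | succ n ih => simp [pw, altc, tc, tb, ih b]; omega

theorem p4_bound {A : Type} {I : Set A} {R : Set (A × A)} {a b c d : A}
    (hsym : ∀ a b : A, (a, b) ∈ R → (b, a) ∈ R)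
    (hab : (a, b) ∈ R) (hbc : (b, c) ∈ R) (hcd : (c, d) ∈ R)
    (hac : (a, c) ∉ R) (had : (a, d) ∉ R) (hbd : (b, d) ∉ R) (m n : ℕ)
    (h : pw a d m ++ (pw c b n ++ [c]) ∈ MarkedLang I R) : m ≤ n := by
  classical
  have hca : (c, a) ∉ R := fun h => hac (hsym _ _ h)
  have hda : (d, a) ∉ R := fun h => had (hsym _ _ h)
  have hdb : (d, b) ∉ R := fun h => hbd (hsym _ _ h)
  have nab : a ≠ b := by rintro rfl; exact hac hbc
  have ncd : c ≠ d := by rintro rfl; exact hbd hbc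
  have nac : a ≠ c := by rintro rfl; exact had hcd
  have nad : a ≠ d := by rintro rfl; exact hbd (hsym _ _ hab)
  have nbc : b ≠ c := by rintro rfl; exact hbd hcd
  have nbd : b ≠ d := by rintro rfl; exact had hab
  let t : A → Bool := fun x => decide (x = c ∨ x = d)
  let k : A → Bool := fun x => decide (x = b ∨ x = c)
  let J : A → Prop := fun x => x = a ∨ x = b ∨ x = c ∨ x = d
  have ta : t a = false := by simp [t, nac, nad]
  have tb : t b = false := by simp [t, nbc, nbd]
  have tc : t c = true := by simp [t]
  have td : t d = true := by simp [t]
  have ka : k a = false := by simp [k, nac, nab]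
  have kb : k b = true := by simp [k]
  have kc : k c = true := by simp [k]
  have kd : k d = false := by simp [k, nbd.symm, ncd.symm]
  have hinv := AltInv_lang I R J t k (by
    rintro x y (rfl | rfl | rfl | rfl) (rfl | rfl | rfl | rfl) hxy ht <;> simp_all) _ h
  have hJ1 : ∀ m, ∀ x ∈ pw a d m, J x := by
    intro m; induction m with
    | zero => simp [pw]
    | succ m ih => simp [pw, J] at *; exact ih
  have hJ2 : ∀ m, ∀ x ∈ pw c b m, J x := by
    intro m; induction m with
    | zero => simp [pw]
    | succ m ih => simp [pw, J] at *; exact ih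
  have k1 : ∀ m, (pw a d m).countP k = 0 := by
    intro m; induction m with
    | zero => simp [pw]
    | succ m ih => rw [pw, List.countP_cons, List.countP_cons, ih, ka, kd]; simp
  have k2 : ∀ m, (pw c b m).countP k = 2 * m := by
    intro m; induction m with
    | zero => simp [pw]
    | succ m ih => rw [pw, List.countP_cons, List.countP_cons, ih, kc, kb]; simp; omega
  have key := hinv (pw a d m ++ pw c b n) c (by simp) (by
    intro x hx
    simp only [List.mem_append, List.mem_singleton] at hx
    rcases hx with hx | hx | rfl
    · exact hJ1 m x hx
    · exact hJ2 n x hx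
    · simp [J])
  rw [altc_pw t ta td m _ c tc, altc_pw2 t tc tb, List.countP_append, List.countP_append, k1, k2,
    List.countP_singleton, kc, td] at key
  simp at key
  omega

theorem exists_p4 {A : Type} (I : Set A) (R : Set (A × A))
    (hd : 3 < localDiam R I) :
    ∃ a b c d : A, (a, b) ∈ R ∧ (b, c) ∈ R ∧ (c, d) ∈ R ∧
      (a, c) ∉ R ∧ (a, d) ∉ R ∧ (b, d) ∉ R := by
  have aux : ∀ S : Set ℕ, 3 < sSup S → ∃ x ∈ S, 3 < x := by
    intro S hS
    rcases S.eq_empty_or_nonempty with rfl | hne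
    · simp at hS
    · exact exists_lt_of_lt_csSup hne hS
  obtain ⟨_, ⟨J, hJI, hJ, rfl⟩, h1⟩ := aux _ hd
  obtain ⟨_, ⟨u, hu, v, hv, rfl⟩, h2⟩ := aux _ h1
  have hmem : RChain R J u v (markedDist R J u v) := Nat.sInf_mem (hJ.1 u hu v hv)
  have hmin : ∀ k, RChain R J u v k → markedDist R J u v ≤ k := fun k hk => Nat.sInf_le hk
  obtain ⟨l, hl, hhead, hlast, hmemJ, hch⟩ := hmem
  rw [← hl] at h2 hmin
  match l, h2 with
  | p :: q :: r :: s :: rest, _ =>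
    have hch' := hch
    simp only [List.Chain', List.isChain_cons_cons] at hch'
    obtain ⟨hpq, hqr, hrs, hrest⟩ := hch'
    simp at hhead
    subst hhead
    refine ⟨p, q, r, s, hpq, hqr, hrs, ?_, ?_, ?_⟩ <;> intro hbad
    · have := hmin _ ⟨p :: r :: s :: rest, rfl, rfl, by simpa using hlast,
        fun c hc => hmemJ c (by simp at hc ⊢; tauto),
        by simp only [List.Chain', List.isChain_cons_cons]; exact ⟨hbad, hrs, hrest⟩⟩
      simp at this
    · have := hmin _ ⟨p :: s :: rest, rfl, rfl, by simpa using hlast,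
        fun c hc => hmemJ c (by simp at hc ⊢; tauto),
        by simp only [List.Chain', List.isChain_cons_cons]; exact ⟨hbad, hrest⟩⟩
      simp at this
    · have := hmin _ ⟨p :: q :: s :: rest, rfl, rfl, by simpa using hlast,
        fun c hc => hmemJ c (by simp at hc ⊢; tauto),
        by simp only [List.Chain', List.isChain_cons_cons]; exact ⟨hpq, hbad, hrest⟩⟩
      simp at this

/-- If a transitive marked system `(I, R)` has local diameter greater than 3, then
the circular language it generates is not regular. -/
theorem stmt8 {A : Type} [Fintype A] (I : Set A) (R : Set (A × A))
    (hsub : ∀ p ∈ R, p.1 ∈ I ∧ p.2 ∈ I)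
    (hsym : ∀ a b : A, (a, b) ∈ R → (b, a) ∈ R)
    (hocc : ∀ a ∈ I, ∃ b, (a, b) ∈ R)
    (htrans : IsTransitiveSubset R I)
    (hd : 3 < localDiam R I) :
    ¬ Language.IsRegular (MarkedLang I R : Language A) := by
  rintro ⟨σ, hσ, M, hM⟩
  obtain ⟨a, b, c, d, hab, hbc, hcd, hac, had, hbd⟩ := exists_p4 I R hd
  have hmem := fun n => lang_mem (I := I) (R := R) (hsub _ hab).1 (hsub _ hab).2 (hsub _ hcd).1
    (hsub _ hcd).2 (hsym _ _ hab) hbc (hsym _ _ hbc) hcd n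
  have hbound := fun m n => p4_bound (I := I) hsym hab hbc hcd hac had hbd m n
  obtain ⟨i, j, hij, he⟩ :=
    Finite.exists_ne_map_eq_of_infinite (fun n : ℕ => M.eval (pw a d n))
  have key : ∀ i j, M.eval (pw a d i) = M.eval (pw a d j) → j ≤ i := by
    intro i j he
    apply hbound j i
    have h1 := hmem i
    have hM' : ∀ w, w ∈ MarkedLang I R ↔ M.eval w ∈ M.accept := by
      intro w
      have : w ∈ M.accepts ↔ M.eval w ∈ M.accept := Iff.rfl
      rw [← this, hM]; rfl
    rw [hM'] at h1 ⊢
    have e : ∀ x y : List A, M.eval (x ++ y) = M.evalFrom (M.eval x) y := fun x y =>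
      M.evalFrom_of_append M.start x y
    rw [e] at h1 ⊢
    rwa [← he]
  exact hij (le_antisymm (key j i he.symm) (key i j he))
end

section
/- Let S = (I,R) be a transitive marked system with local diameter δ_ℓ(S) ≤ 3 and let w ∈ I^+. If alph(w) is a transitive subset of I and |w| ≥ 2, then ~w ∈ L(I,R). Consequently, L(I,R) = I ∪ ⋃_{J ⊆ I, J transitive} ~( ⋂_{a ∈ J} J* a J* ), i.e., L(I,R) consists of the one-letter circular words of I together with all circular words ~w with |w| ≥ 2 whose set of letters alph(w) is a transitive subset J of I. -/
section helpers

variable {A : Type*}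

theorem aux_step {I : Set A} {R : Set (A × A)} {w x y : List A} {a b : A}
    (hab : (a, b) ∈ R) (hx : x ++ [a] ∈ MarkedLang I R) (hy : y ++ [b] ∈ MarkedLang I R)
    (hw : WordConj w (x ++ [a] ++ y ++ [b])) : w ∈ MarkedLang I R := by
  intro L hL
  exact hL.2 w ⟨a, b, x, y, hab, hx L hL, hy L hL, hw⟩

theorem aux_single {I : Set A} {R : Set (A × A)} {a : A} (ha : a ∈ I) :
    [a] ∈ MarkedLang I R := fun _ hL => hL.1 a ha

/-- consecutive letters of different types -/
theorem aux_adj (X : Set A) (l : List A) (b : A) (hb : b ∉ X) (h : ∃ c ∈ l, c ∈ X) :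
    ∃ s a c t, l ++ [b] = s ++ a :: c :: t ∧ a ∈ X ∧ c ∉ X := by
  induction l with
  | nil => simp at h
  | cons d l ih =>
    by_cases h' : ∃ c ∈ l, c ∈ X
    · obtain ⟨s, a, c, t, h1, h2, h3⟩ := ih h'
      exact ⟨d :: s, a, c, t, by simp [h1], h2, h3⟩
    · have hd : d ∈ X := by
        obtain ⟨c, hc, hcX⟩ := h
        rcases List.mem_cons.1 hc with rfl | hc
        · exact hcX
        · exact absurd ⟨c, hc, hcX⟩ h'
      cases l with
      | nil => exact ⟨[], d, b, [], rfl, hd, hb⟩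
      | cons e l =>
        refine ⟨[], d, e, l ++ [b], rfl, hd, fun he => h' ⟨e, by simp, he⟩⟩

theorem aux_rot (X : Set A) (w : List A) (h1 : ∃ c ∈ w, c ∈ X) (h2 : ∃ c ∈ w, c ∉ X) :
    ∃ p a b, w ~r (p ++ [a, b]) ∧ a ∈ X ∧ b ∉ X := by
  obtain ⟨b, hbw, hb⟩ := h2
  obtain ⟨s, t, rfl⟩ := List.append_of_mem hbw
  have : ∃ c ∈ t ++ s, c ∈ X := by
    obtain ⟨c, hc, hcX⟩ := h1
    refine ⟨c, ?_, hcX⟩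
    have : c ≠ b := by rintro rfl; exact hb hcX
    simp only [List.mem_append, List.mem_cons] at hc ⊢
    tauto
  obtain ⟨s', a, c, t', h, ha, hc⟩ := aux_adj X _ b hb this
  refine ⟨t' ++ s', a, c, ?_, ha, hc⟩
  have e1 : (s ++ b :: t) ~r (t ++ s ++ [b]) := by
    have := List.isRotated_append (l := s ++ [b]) (l' := t)
    simpa using this
  rw [h] at e1
  refine e1.trans ?_
  have := List.isRotated_append (l := s' ++ [a, c]) (l' := t')
  simpa using this

theorem aux_conj {w w' : List A} (h : w ~r w') : WordConj w w' := by
  obtain ⟨n, hn, rfl⟩ := List.isRotated_iff_mod.1 h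
  exact ⟨w.take n, w.drop n, (List.take_append_drop n w).symm,
    List.rotate_eq_drop_append_take hn⟩

theorem aux_conj_mem {w w' : List A} (h : WordConj w w') (c : A) : c ∈ w ↔ c ∈ w' := by
  obtain ⟨x, y, rfl, rfl⟩ := h
  simp [or_comm]

theorem aux_word {I : Set A} {R : Set (A × A)} (hsym : ∀ a b : A, (a, b) ∈ R → (b, a) ∈ R)
    (M X : Set A) (hMI : M ⊆ I)
    (hj : ∀ p ∈ M, ∀ q ∈ M, p ∈ X → q ∉ X → (p, q) ∈ R) (n : ℕ) :
    ∀ w : List A, w.length = n → (∀ c ∈ w, c ∈ M) → (∃ c ∈ w, c ∈ X) → (∃ c ∈ w, c ∉ X) →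
      w ∈ MarkedLang I R := by
  induction n with
  | zero =>
    intro w hw _ h
    rw [List.length_eq_zero_iff] at hw
    subst hw
    simp at h
  | succ n ih =>
    intro w hw hM h1 h2
    obtain ⟨p, a, b, hr, ha, hb⟩ := aux_rot X w h1 h2
    have hmem : ∀ c, c ∈ w ↔ c ∈ p ++ [a, b] := fun c => hr.mem_iff
    have hlen : w.length = (p ++ [a, b]).length := hr.perm.length_eq
    have hM' : ∀ c ∈ p ++ [a, b], c ∈ M := fun c hc => hM c ((hmem c).2 hc)
    have haM : a ∈ M := hM' a (by simp)
    have hbM : b ∈ M := hM' b (by simp)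
    have hab := hj a haM b hbM ha hb
    by_cases hp : ∃ c ∈ p, c ∉ X
    · obtain ⟨c, hcp, hc⟩ := hp
      refine aux_step (x := p) (y := []) hab (ih (p ++ [a]) ?_ ?_ ?_ ?_)
        (aux_single (hMI hbM)) ?_
      · simp at hlen ⊢; omega
      · intro c hc; apply hM'; simp at hc ⊢; tauto
      · exact ⟨a, by simp, ha⟩
      · exact ⟨c, by simp [hcp], hc⟩
      · apply aux_conj; simpa using hr
    · cases p with
      | nil =>
        refine aux_step (x := []) (y := []) hab (aux_single (hMI haM))
          (aux_single (hMI hbM)) ?_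
        apply aux_conj; simpa using hr
      | cons c p =>
        have hcM : c ∈ M := hM' c (by simp)
        have hc : c ∈ X := by
          by_contra h
          exact hp ⟨c, by simp, h⟩
        refine aux_step (x := p ++ [a]) (y := []) (hsym _ _ (hj c hcM b hbM hc hb))
          (ih (p ++ [a] ++ [b]) ?_ ?_ ?_ ?_) (aux_single (hMI hcM)) ?_
        · simp at hlen ⊢; omega
        · intro c hc; apply hM'; simp at hc ⊢; tauto
        · exact ⟨a, by simp, ha⟩
        · exact ⟨b, by simp, hb⟩
        · apply aux_conj
          refine hr.trans ?_
          have := List.isRotated_append (l := [c]) (l' := p ++ [a, b])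
          simpa using this

theorem aux_loop {I : Set A} {R : Set (A × A)} {a : A} (ha : a ∈ I) (haa : (a, a) ∈ R) (n : ℕ) :
    List.replicate (n + 1) a ∈ MarkedLang I R := by
  induction n with
  | zero => exact aux_single ha
  | succ n ih =>
    refine aux_step (x := List.replicate n a) (y := []) haa ?_ (aux_single ha) ?_
    · rwa [← List.replicate_succ']
    · apply aux_conj
      rw [List.replicate_succ', List.replicate_succ']
      simp [List.IsRotated.refl]

/-- reachability inside `J` -/
def Rch (R : Set (A × A)) (J : Set A) : A → A → Prop :=
  Relation.ReflTransGen (fun x y => (x, y) ∈ R ∧ x ∈ J ∧ y ∈ J)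

theorem aux_rch_of {R : Set (A × A)} {J : Set A} {a b : A} {k : ℕ} (h : RChain R J a b k) :
    Rch R J a b := by
  obtain ⟨l, -, hh, hl, hJ, hc⟩ := h
  induction l generalizing a with
  | nil => simp at hh
  | cons c l ih =>
    simp at hh
    subst hh
    cases l with
    | nil => simp at hl; subst hl; exact Relation.ReflTransGen.refl
    | cons d l =>
      have hc' := List.isChain_cons_cons.1 hc
      refine Relation.ReflTransGen.head ⟨hc'.1, hJ _ (by simp), hJ _ (by simp)⟩
        (ih rfl (by simpa using hl) (fun c hc => hJ c (by simp [hc])) hc'.2)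

theorem aux_of_rch {R : Set (A × A)} {J : Set A} {a b : A} (ha : a ∈ J) (h : Rch R J a b) :
    ∃ k, RChain R J a b k := by
  induction h using Relation.ReflTransGen.head_induction_on with
  | refl => exact ⟨1, [b], rfl, rfl, rfl, by simpa using ha, List.isChain_singleton b⟩
  | @head x y h1 _ ih =>
    obtain ⟨k, l, h2, h3, h4, h5, h6⟩ := ih h1.2.2
    refine ⟨k + 1, x :: l, by simp [h2], rfl, ?_, ?_, ?_⟩
    · cases l with
      | nil => simp at h3
      | cons d l => simpa using h4
    · intro c hc
      rcases List.mem_cons.1 hc with rfl | hc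
      · exact ha
      · exact h5 c hc
    · cases l with
      | nil => simp at h3
      | cons d l =>
        simp at h3
        subst h3
        exact List.isChain_cons_cons.2 ⟨h1.1, h6⟩

theorem aux_rch_mono {R : Set (A × A)} {J K : Set A} (hJK : J ⊆ K) {a b : A}
    (h : Rch R J a b) : Rch R K a b :=
  Relation.ReflTransGen.mono (fun _ _ h => ⟨h.1, hJK h.2.1, hJK h.2.2⟩) _ _ h

theorem aux_rch_symm {R : Set (A × A)} (hsym : ∀ a b : A, (a, b) ∈ R → (b, a) ∈ R)
    {J : Set A} {a b : A} (h : Rch R J a b) : Rch R J b a := by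
  induction h with
  | refl => exact Relation.ReflTransGen.refl
  | tail _ h ih => exact Relation.ReflTransGen.head ⟨hsym _ _ h.1, h.2.2, h.2.1⟩ ih

theorem aux_dist [Finite A] {I : Set A} {R : Set (A × A)} (hd : localDiam R I ≤ 3)
    {J : Set A} (hJ : J ⊆ I) (ht : IsTransitiveSubset R J) {a b : A} (ha : a ∈ J) (hb : b ∈ J) :
    ∃ k ≤ 3, RChain R J a b k := by
  refine ⟨markedDist R J a b, ?_, Nat.sInf_mem (ht.1 a ha b hb)⟩
  refine le_trans (le_trans (b := globalDiam R J) ?_ ?_) hd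
  · apply le_csSup
    · apply Set.Finite.bddAbove
      refine (Set.finite_range (fun p : A × A => markedDist R J p.1 p.2)).subset ?_
      rintro d ⟨a, _, b, _, rfl⟩
      exact ⟨(a, b), rfl⟩
    · exact ⟨a, ha, b, hb, rfl⟩
  · apply le_csSup
    · apply Set.Finite.bddAbove
      refine (Set.finite_range (fun J : Set A => globalDiam R J)).subset ?_
      rintro d ⟨J, _, _, rfl⟩
      exact ⟨J, rfl⟩
    · exact ⟨J, hJ, ht, rfl⟩

theorem aux_short {R : Set (A × A)} {J : Set A} {a b : A} {k : ℕ} (hk : k ≤ 3)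
    (h : RChain R J a b k) :
    a = b ∨ (a, b) ∈ R ∨ ∃ z ∈ J, (a, z) ∈ R ∧ (z, b) ∈ R := by
  obtain ⟨l, h2, h3, h4, h5, h6⟩ := h
  match l, h2, h3, h4, h5, h6 with
  | [], _, h3, _, _, _ => simp at h3
  | [x], _, h3, h4, _, _ => simp at h3 h4; left; rw [← h3, ← h4]
  | [x, y], _, h3, h4, _, h6 =>
    simp at h3 h4; subst h3; subst h4
    right; left; exact (List.isChain_cons_cons.1 h6).1
  | [x, y, z], _, h3, h4, h5, h6 =>
    simp at h3 h4; subst h3; subst h4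
    right; right
    have h7 := List.isChain_cons_cons.1 h6
    exact ⟨y, h5 y (by simp), h7.1, (List.isChain_cons_cons.1 h7.2).1⟩
  | x :: y :: z :: t :: l, h2, _, _, _, _ => simp at h2; omega

theorem aux_p4 [Finite A] {I : Set A} {R : Set (A × A)}
    (hsym : ∀ a b : A, (a, b) ∈ R → (b, a) ∈ R) (hd : localDiam R I ≤ 3)
    {v p y q : A} (hv : v ∈ I) (hp : p ∈ I) (hy : y ∈ I) (hq : q ∈ I)
    (hvp : (v, p) ∈ R) (hpy : (p, y) ∈ R) (hyq : (y, q) ∈ R) (hne : v ≠ q)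
    (hvy : (v, y) ∉ R) (hvq : (v, q) ∉ R) : (p, q) ∈ R := by
  set J : Set A := {v, p, y, q} with hJ
  have mv : v ∈ J := by simp [hJ]
  have mp : p ∈ J := by simp [hJ]
  have my : y ∈ J := by simp [hJ]
  have mq : q ∈ J := by simp [hJ]
  have rp : Rch R J v p := Relation.ReflTransGen.single ⟨hvp, mv, mp⟩
  have ry : Rch R J v y := Relation.ReflTransGen.tail rp ⟨hpy, mp, my⟩
  have rq : Rch R J v q := Relation.ReflTransGen.tail ry ⟨hyq, my, mq⟩
  have key : ∀ c ∈ J, Rch R J v c := by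
    intro c hc
    rcases hc with rfl | rfl | rfl | rfl
    · exact Relation.ReflTransGen.refl
    · exact rp
    · exact ry
    · exact rq
  have ht : IsTransitiveSubset R J := by
    refine ⟨fun a ha b hb => aux_of_rch ha ?_, Or.inl ?_⟩
    · exact Relation.ReflTransGen.trans (aux_rch_symm hsym (key a ha)) (key b hb)
    · rw [Set.one_lt_ncard (Set.toFinite J)]
      exact ⟨v, mv, q, mq, hne⟩
  have hJI : J ⊆ I := by
    intro c hc
    rcases hc with rfl | rfl | rfl | rfl <;> assumption
  obtain ⟨k, hk, hc⟩ := aux_dist hd hJI ht mv mq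
  rcases aux_short hk hc with h | h | ⟨z, hz, h1, h2⟩
  · exact absurd h hne
  · exact absurd h hvq
  · rcases hz with rfl | rfl | rfl | rfl
    · exact absurd h2 hvq
    · exact h2
    · exact absurd h1 hvy
    · exact absurd h1 hvq

/-- `M` is a join of two nonempty parts. -/
def IsJn (R : Set (A × A)) (M : Set A) : Prop :=
  ∃ X : Set A, (∃ c ∈ M, c ∈ X) ∧ (∃ c ∈ M, c ∉ X) ∧
    ∀ p ∈ M, ∀ q ∈ M, p ∈ X → q ∉ X → (p, q) ∈ R

theorem aux_ext [Finite A] {I : Set A} {R : Set (A × A)}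
    (hsym : ∀ a b : A, (a, b) ∈ R → (b, a) ∈ R) (hd : localDiam R I ≤ 3)
    {M : Set A} (hMI : M ⊆ I) (hM : IsJn R M) {v m : A} (hv : v ∈ I) (hvM : v ∉ M)
    (hm : m ∈ M) (hvm : (v, m) ∈ R) : IsJn R (insert v M) := by
  obtain ⟨X, ⟨x, hxM, hx⟩, ⟨y, hyM, hy⟩, hj⟩ := hM
  have hne : ∀ c ∈ M, c ≠ v := by rintro c hc rfl; exact hvM hc
  by_cases hX : ∀ c ∈ M, c ∈ X → (v, c) ∈ R
  · refine ⟨X \ {v}, ⟨x, Or.inr hxM, hx, hne x hxM⟩, ⟨v, Or.inl rfl, by simp⟩, ?_⟩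
    rintro p hp q hq ⟨hpX, hpv⟩ hqX
    have hpM : p ∈ M := by rcases hp with h | h; exacts [absurd h hpv, h]
    rcases hq with rfl | hq
    · exact hsym _ _ (hX p hpM hpX)
    · exact hj p hpM q hq hpX (fun h => hqX ⟨h, hne q hq⟩)
  by_cases hY : ∀ c ∈ M, c ∉ X → (v, c) ∈ R
  · refine ⟨insert v X, ⟨v, Or.inl rfl, Or.inl rfl⟩, ⟨y, Or.inr hyM, ?_⟩, ?_⟩
    · rintro (h | h)
      exacts [hne y hyM h, hy h]
    · rintro p hp q hq hpX hqX
      have hqv : q ≠ v := fun h => hqX (Or.inl h)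
      have hqX' : q ∉ X := fun h => hqX (Or.inr h)
      have hqM : q ∈ M := by rcases hq with h | h; exacts [absurd h hqv, h]
      by_cases hpv : p = v
      · rw [hpv]; exact hY q hqM hqX'
      · exact hj p (hp.resolve_left hpv) q hqM (hpX.resolve_left hpv) hqX'
  push Not at hX hY
  obtain ⟨x, hxM, hx, hvx⟩ := hX
  obtain ⟨y, hyM, hy, hvy⟩ := hY
  refine ⟨{c | c ∈ M ∧ (v, c) ∈ R}, ⟨m, Or.inr hm, hm, hvm⟩,
    ⟨v, Or.inl rfl, fun h => hvM h.1⟩, ?_⟩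
  rintro p - q hq ⟨hpM, hvp⟩ hq'
  rcases hq with rfl | hqM
  · exact hsym _ _ hvp
  have hvq : (v, q) ∉ R := fun h => hq' ⟨hqM, h⟩
  by_cases hpX : p ∈ X <;> by_cases hqX : q ∈ X
  · exact aux_p4 hsym hd hv (hMI hpM) (hMI hyM) (hMI hqM) hvp (hj p hpM y hyM hpX hy)
      (hsym _ _ (hj q hqM y hyM hqX hy)) (hne q hqM).symm hvy hvq
  · exact hj p hpM q hqM hpX hqX
  · exact hsym _ _ (hj q hqM p hpM hqX hpX)
  · exact aux_p4 hsym hd hv (hMI hpM) (hMI hxM) (hMI hqM) hvp (hsym _ _ (hj x hxM p hpM hx hpX))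
      (hj x hxM q hqM hx hqX) (hne q hqM).symm hvx hvq

/-- crossing edge -/
theorem aux_cross {R : Set (A × A)} {J M : Set A} {a b : A} (h : Rch R J a b) (ha : a ∈ M)
    (hb : b ∉ M) : ∃ m v, m ∈ M ∧ v ∉ M ∧ v ∈ J ∧ (m, v) ∈ R := by
  induction h with
  | refl => exact absurd ha hb
  | tail _ h ih =>
    rename_i c d _
    by_cases hc : c ∈ M
    · exact ⟨c, d, hc, hb, h.2.2, h.1⟩
    · exact ih hc

theorem aux_join [Finite A] {I : Set A} {R : Set (A × A)}
    (hsym : ∀ a b : A, (a, b) ∈ R → (b, a) ∈ R) (hd : localDiam R I ≤ 3)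
    {J : Set A} (hJI : J ⊆ I) (hc : ∀ a ∈ J, ∀ b ∈ J, Rch R J a b) (h1 : 1 < J.ncard) :
    IsJn R J := by
  obtain ⟨a, ha, b, hb, hab⟩ := (Set.one_lt_ncard (Set.toFinite J)).1 h1
  obtain ⟨m, v, hm, hv, hvJ, hmv⟩ := aux_cross (M := {a}) (hc a ha b hb) rfl (Ne.symm hab)
  have hma : m = a := hm
  subst hma
  have h0 : IsJn R ({m, v} : Set A) := by
    refine ⟨{m}, ⟨m, by simp, rfl⟩, ⟨v, by simp, hv⟩, ?_⟩
    rintro p - q hq hp hq'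
    have hp' : p = m := hp
    subst hp'
    rcases hq with h | h
    · exact absurd h hq'
    · have h' : q = v := h
      rwa [h']
  have hfin : {M : Set A | M ⊆ J ∧ IsJn R M}.Finite := Set.toFinite _
  obtain ⟨M, hM⟩ := hfin.exists_maximal
    ⟨{m, v}, by rintro c (rfl | rfl) <;> assumption, h0⟩
  have hMJ : M = J := by
    by_contra hne
    have hssub := hM.prop.1
    obtain ⟨j, hj, hjM⟩ : ∃ j ∈ J, j ∉ M := by
      by_contra h
      push Not at h
      exact hne (Set.Subset.antisymm hssub h)
    obtain ⟨X, ⟨x, hx, -⟩, -⟩ := hM.prop.2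
    obtain ⟨m, v, hm, hv, hvJ, hmv⟩ := aux_cross (hc x (hssub hx) j hj) hx hjM
    have := hM.le_of_ge (y := insert v M)
      ⟨Set.insert_subset hvJ hssub, aux_ext hsym hd (hssub.trans hJI) hM.prop.2 (hJI hvJ) hv hm
        (hsym _ _ hmv)⟩ (Set.subset_insert v M)
    exact hv (this (Set.mem_insert v M))
  exact hMJ ▸ hM.prop.2

theorem aux_main [Finite A] {I : Set A} {R : Set (A × A)}
    (hsym : ∀ a b : A, (a, b) ∈ R → (b, a) ∈ R) (hd : localDiam R I ≤ 3)
    (w : List A) (hw : ∀ c ∈ w, c ∈ I) (ht : IsTransitiveSubset R {c | c ∈ w}) :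
    w ∈ MarkedLang I R := by
  obtain ⟨hc, h | ⟨a, ha, haa⟩⟩ := ht
  · obtain ⟨X, h1, h2, h3⟩ := aux_join hsym hd hw
      (fun a ha b hb => aux_rch_of (hc a ha b hb).choose_spec) h
    exact aux_word hsym _ X hw h3 _ w rfl (fun _ h => h) h1 h2
  · have haw : a ∈ w := by
      have : a ∈ {c | c ∈ w} := by rw [ha]; rfl
      exact this
    have hall : ∀ c ∈ w, c = a := by
      intro c hc
      have : c ∈ {c | c ∈ w} := hc
      rw [ha] at this
      exact this
    have hrep := List.eq_replicate_of_mem hall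
    obtain ⟨n, hn⟩ := Nat.exists_eq_succ_of_ne_zero
      (List.length_pos_of_mem haw).ne'
    rw [hrep, hn]
    exact aux_loop (hw a haw) haa n

theorem aux_conv [Finite A] {I : Set A} {R : Set (A × A)}
    (hsym : ∀ a b : A, (a, b) ∈ R → (b, a) ∈ R)
    (w : List A) (h : w ∈ MarkedLang I R) : (∀ c ∈ w, c ∈ I) ∧
      (∀ c ∈ w, ∀ d ∈ w, Rch R {c | c ∈ w} c d) ∧
      ((∃ a, w = [a]) ∨ IsTransitiveSubset R {c | c ∈ w}) := by
  refine h {w | (∀ c ∈ w, c ∈ I) ∧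
      (∀ c ∈ w, ∀ d ∈ w, Rch R {c | c ∈ w} c d) ∧
      ((∃ a, w = [a]) ∨ IsTransitiveSubset R {c | c ∈ w})} ⟨?_, ?_⟩
  · intro a ha
    refine ⟨by simpa using ha, ?_, Or.inl ⟨a, rfl⟩⟩
    intro c hc d hd
    simp at hc hd
    subst hc; subst hd
    exact Relation.ReflTransGen.refl
  · rintro w ⟨a, b, x, y, hab, ⟨hx1, hx2, -⟩, ⟨hy1, hy2, -⟩, hw⟩
    have hmem : ∀ c, c ∈ w ↔ c ∈ x ++ [a] ∨ c ∈ y ++ [b] := by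
      intro c
      rw [aux_conj_mem hw c, List.append_assoc, List.mem_append]
    have haw : a ∈ w := (hmem a).2 (by simp)
    have hbw : b ∈ w := (hmem b).2 (by simp)
    have hax : ∀ c ∈ w, Rch R {c | c ∈ w} a c := by
      intro c hc
      rcases (hmem c).1 hc with h | h
      · exact aux_rch_mono (fun c h => (hmem c).2 (Or.inl h)) (hx2 a (by simp) c h)
      · exact Relation.ReflTransGen.head ⟨hab, haw, hbw⟩
          (aux_rch_mono (fun c h => (hmem c).2 (Or.inr h)) (hy2 b (by simp) c h))
    have hcon : ∀ c ∈ w, ∀ d ∈ w, Rch R {c | c ∈ w} c d := fun c hc d hd =>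
      Relation.ReflTransGen.trans (aux_rch_symm hsym (hax c hc)) (hax d hd)
    refine ⟨?_, hcon, Or.inr ⟨fun c hc d hd => aux_of_rch hc (hcon c hc d hd), ?_⟩⟩
    · intro c hc
      rcases (hmem c).1 hc with h | h
      exacts [hx1 c h, hy1 c h]
    · by_cases hs : ∀ c ∈ w, c = a
      · right
        have hba := hs b hbw
        subst hba
        exact ⟨b, Set.Subset.antisymm hs (by rintro c rfl; exact hbw), hab⟩
      · left
        push Not at hs
        obtain ⟨c, hc, hne⟩ := hs
        rw [Set.one_lt_ncard (Set.toFinite _)]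
        exact ⟨c, hc, a, haw, hne⟩

end helpers

/-- Let `(I, R)` be a transitive marked system with local diameter at most 3. Every
word `w ∈ I^+` with `|w| ≥ 2` whose set of letters is a transitive subset of `I`
satisfies `~w ∈ L(I,R)`; consequently, `L(I,R)` consists of the one-letter circular
words of `I` together with all circular words whose set of letters is a transitive
subset `J` of `I` (i.e., `L(I,R) = I ∪ ⋃_{J ⊆ I transitive} ~(⋂_{a ∈ J} J* a J*)`). -/
theorem stmt9 {A : Type} [Fintype A] (I : Set A) (R : Set (A × A))
    (hsub : ∀ p ∈ R, p.1 ∈ I ∧ p.2 ∈ I)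
    (hsym : ∀ a b : A, (a, b) ∈ R → (b, a) ∈ R)
    (hocc : ∀ a ∈ I, ∃ b, (a, b) ∈ R)
    (htrans : IsTransitiveSubset R I)
    (hd : localDiam R I ≤ 3) :
    (∀ w : List A, (∀ c ∈ w, c ∈ I) → 2 ≤ w.length →
        IsTransitiveSubset R {c | c ∈ w} → w ∈ MarkedLang I R) ∧
      MarkedLang I R =
        {w : List A | ∃ a ∈ I, w = [a]} ∪
          {w : List A | ∃ J : Set A, J ⊆ I ∧ IsTransitiveSubset R J ∧
            {c | c ∈ w} = J} := by
  refine ⟨fun w hw _ ht => aux_main hsym hd w hw ht, Set.Subset.antisymm ?_ ?_⟩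
  · intro w hw
    obtain ⟨h1, -, h | h⟩ := aux_conv hsym w hw
    · obtain ⟨a, rfl⟩ := h
      exact Or.inl ⟨a, h1 a (by simp), rfl⟩
    · exact Or.inr ⟨_, h1, h, rfl⟩
  · rintro w (⟨a, ha, rfl⟩ | ⟨J, hJ, ht, rfl⟩)
    · exact aux_single ha
    · exact aux_main hsym hd w hJ ht
end
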